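/- arXiv:1905.13193 — 2 statements merged into one kernel-verified Lean document; each statement's English description precedes it below -/
import Mathlib

section
/- Let n = 2 and let u : ℝ² → ℝ be a bounded stable solution of Δu + c·L[u] + f(u) = 0 in ℝ², of class C³ with bounded first, second and third derivatives, where the jump kernel J is truncated: there exist constants 0 < δ₁ ≤ δ₀, 0 < λ ≤ Λ and 0 < β, α < 2 such that λ|z|^{−n−β}·1_{{|z| ≤ δ₁}} ≤ J(z) ≤ Λ|z|^{−n−α}·1_{{|z| ≤ δ₀}} for all z ≠ 0. Then u is one-dimensional: there exist a unit vector e ∈ ℝ² and a function g : ℝ → ℝ such that u(x) = g(e·x) for all x ∈ ℝ². -/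
open MeasureTheory Filter Set Metric
open scoped Topology

noncomputable section

/-- The truncated nonlocal integral `∫_{{y : |x-y| > ε}} (u(y) - u(x)) J(x-y) dy`. -/
def truncI {n : ℕ} (J u : EuclideanSpace ℝ (Fin n) → ℝ)
    (x : EuclideanSpace ℝ (Fin n)) (ε : ℝ) : ℝ :=
  ∫ y in {y : EuclideanSpace ℝ (Fin n) | ε < dist x y}, (u y - u x) * J (x - y)

/-- `HasPV J u x ℓ` : the principal value `L[u](x) = lim_{ε→0⁺} ∫_{|x-y|>ε} (u(y)-u(x)) J(x-y) dy`
exists and equals `ℓ`. -/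
def HasPV {n : ℕ} (J u : EuclideanSpace ℝ (Fin n) → ℝ)
    (x : EuclideanSpace ℝ (Fin n)) (ℓ : ℝ) : Prop :=
  Tendsto (fun ε => truncI J u x ε) (𝓝[>] (0:ℝ)) (𝓝 ℓ)

/-- The Laplacian `Δu(x) = ∑ᵢ ∂²u/∂xᵢ²(x)`. -/
def lap {n : ℕ} (u : EuclideanSpace ℝ (Fin n) → ℝ) (x : EuclideanSpace ℝ (Fin n)) : ℝ :=
  ∑ i : Fin n, iteratedFDeriv ℝ 2 u x ![EuclideanSpace.single i 1, EuclideanSpace.single i 1]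

/-- `u` together with its iterated derivatives up to order `k` is bounded. -/
def BddDerivs {n : ℕ} (k : ℕ) (u : EuclideanSpace ℝ (Fin n) → ℝ) : Prop :=
  ∀ j ≤ k, ∃ M, ∀ x, ‖iteratedFDeriv ℝ j u x‖ ≤ M

/-- Variational stability of a solution `u`: for every compactly supported Lipschitz `ζ`,
`∫ f'(u) ζ² ≤ ∫ |∇ζ|² + (c/2) ∬ (ζ(x)-ζ(y))² J(x-y)`. -/
def IsStable {n : ℕ} (J : EuclideanSpace ℝ (Fin n) → ℝ) (c : ℝ)
    (f : ℝ → ℝ) (u : EuclideanSpace ℝ (Fin n) → ℝ) : Prop :=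
  ∀ ζ : EuclideanSpace ℝ (Fin n) → ℝ, (∃ K, LipschitzWith K ζ) → HasCompactSupport ζ →
    (∫ x, deriv f (u x) * ζ x ^ 2) ≤
      (∫ x, ‖gradient ζ x‖ ^ 2) + (c / 2) * ∫ x, ∫ y, (ζ x - ζ y) ^ 2 * J (x - y)


/-- The plane. -/
abbrev EE := EuclideanSpace ℝ (Fin 2)

/-- Standard basis vector. -/
def be (i : Fin 2) : EE := EuclideanSpace.single i (1:ℝ)

/-- Partial derivative. -/
def pd (i : Fin 2) (g : EE → ℝ) (x : EE) : ℝ := fderiv ℝ g x (be i)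

lemma norm_be (i : Fin 2) : ‖be i‖ = 1 := by simp [be]

lemma pd_contDiff {m n : ℕ} (i : Fin 2) {g : EE → ℝ} (hg : ContDiff ℝ n g) (hmn : m + 1 ≤ n) :
    ContDiff ℝ m (pd i g) := by
  unfold pd
  have : ContDiff ℝ m (fderiv ℝ g) := hg.fderiv_right (by exact_mod_cast hmn)
  exact this.clm_apply contDiff_const

lemma pd_pd {g : EE → ℝ} (hg : ContDiff ℝ 2 g) (i j : Fin 2) (x : EE) :
    pd i (pd j g) x = fderiv ℝ (fderiv ℝ g) x (be i) (be j) := by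
  have : DifferentiableAt ℝ (fderiv ℝ g) x :=
    ((hg.fderiv_right (m := 1) (by norm_num)).differentiable (by norm_num)) x
  unfold pd
  rw [fderiv_clm_apply this (by fun_prop)]
  simp

lemma pd_comm {g : EE → ℝ} (hg : ContDiff ℝ 2 g) (i j : Fin 2) (x : EE) :
    pd i (pd j g) x = pd j (pd i g) x := by
  rw [pd_pd hg, pd_pd hg]
  have h := (hg.contDiffAt (x := x)).isSymmSndFDerivAt (by simp)
  exact h (be i) (be j)

lemma lap_eq {u : EE → ℝ} (hu : ContDiff ℝ 2 u) (x : EE) :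
    lap u x = ∑ i, pd i (pd i u) x := by
  unfold lap
  refine Finset.sum_congr rfl fun i _ => ?_
  rw [pd_pd hu, iteratedFDeriv_two_apply]
  rfl

lemma pd_eq_zero {g : EE → ℝ} {i : Fin 2} {x : EE} (hx : x ∉ tsupport g) : pd i g x = 0 := by
  unfold pd
  rw [fderiv_of_notMem_tsupport ℝ hx]; simp

lemma pd_hcs {g : EE → ℝ} (i : Fin 2) (hg : HasCompactSupport g) : HasCompactSupport (pd i g) := by
  refine HasCompactSupport.intro hg fun x hx => pd_eq_zero hx

lemma ibp {g h : EE → ℝ} (i : Fin 2) (hg : ContDiff ℝ 1 g) (hh : ContDiff ℝ 1 h)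
    (hc : HasCompactSupport h) : ∫ x, g x * pd i h x = - ∫ x, pd i g x * h x := by
  have h1 : Continuous (pd i g) := (pd_contDiff (m := 0) i (n := 1) hg le_rfl).continuous
  have h2 : Continuous (pd i h) := (pd_contDiff (m := 0) i (n := 1) hh le_rfl).continuous
  unfold pd
  apply integral_mul_fderiv_eq_neg_fderiv_mul_of_integrable
  · exact (h1.mul hh.continuous).integrable_of_hasCompactSupport hc.mul_left
  · exact (hg.continuous.mul h2).integrable_of_hasCompactSupport (pd_hcs i hc).mul_left
  · exact (hg.continuous.mul hh.continuous).integrable_of_hasCompactSupport hc.mul_left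
  · exact fun x _ => hg.differentiable (by norm_num) x
  · exact fun x _ => hh.differentiable (by norm_num) x

lemma grad_inner (g : EE → ℝ) (x v : EE) : inner ℝ (gradient g x) v = fderiv ℝ g x v := by
  unfold gradient
  rw [InnerProductSpace.toDual_symm_apply (𝕜 := ℝ) (E := EE)]

lemma grad_coord (g : EE → ℝ) (x : EE) (i : Fin 2) : gradient g x i = pd i g x := by
  have := grad_inner g x (be i)
  rw [pd, ← this, be, EuclideanSpace.inner_single_right]
  simp

lemma grad_norm_sq (g : EE → ℝ) (x : EE) :
    ‖gradient g x‖ ^ 2 = pd 0 g x ^ 2 + pd 1 g x ^ 2 := by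
  rw [EuclideanSpace.real_norm_sq_eq]; simp [grad_coord]

lemma grad_inner_eq (g : EE → ℝ) (x y : EE) :
    inner ℝ (gradient g x) (gradient g y) = pd 0 g x * pd 0 g y + pd 1 g x * pd 1 g y := by
  rw [PiLp.inner_apply]; simp [grad_coord]; ring

lemma grad_sub_norm (g : EE → ℝ) (x y : EE) :
    ‖gradient g x - gradient g y‖ = ‖fderiv ℝ g x - fderiv ℝ g y‖ := by
  unfold gradient
  rw [← map_sub, LinearIsometryEquiv.norm_map]

/-- bounded-derivative package -/
lemma bdd_fderiv {u : EE → ℝ} (hu : ContDiff ℝ 3 u) (hub : BddDerivs 3 u) :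
    ∃ M, 0 ≤ M ∧ (∀ x, |u x| ≤ M) ∧ (∀ x, ‖fderiv ℝ u x‖ ≤ M) ∧
      (∀ x y, ‖fderiv ℝ u x - fderiv ℝ u y‖ ≤ M * ‖x - y‖) := by
  obtain ⟨M0, h0⟩ := hub 0 (by norm_num)
  obtain ⟨M1, h1⟩ := hub 1 (by norm_num)
  obtain ⟨M2, h2⟩ := hub 2 (by norm_num)
  have n0 : 0 ≤ M0 := (norm_nonneg _).trans (h0 0)
  have n1 : 0 ≤ M1 := (norm_nonneg _).trans (h1 0)
  have n2 : 0 ≤ M2 := (norm_nonneg _).trans (h2 0)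
  refine ⟨M0 + M1 + M2, by positivity, fun x => ?_, fun x => ?_, fun x y => ?_⟩
  · have := h0 x
    simp at this; linarith
  · have := h1 x
    rw [← norm_iteratedFDeriv_fderiv (n := 0)] at this
    simp at this; linarith
  · have hd : Differentiable ℝ (fderiv ℝ u) :=
      (hu.fderiv_right (m := 2) (by norm_num)).differentiable (by norm_num)
    have hb : ∀ z ∈ (univ : Set EE), ‖fderiv ℝ (fderiv ℝ u) z‖ ≤ M2 := fun z _ => by
      have := h2 z
      rw [← norm_iteratedFDeriv_fderiv (n := 1), ← norm_iteratedFDeriv_fderiv (n := 0)] at this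
      simpa using this
    have := convex_univ.norm_image_sub_le_of_norm_fderiv_le (fun z _ => hd z) hb (mem_univ y) (mem_univ x)
    refine this.trans ?_
    gcongr; linarith

lemma second_diff {u : EE → ℝ} (hu : ContDiff ℝ 3 u) {M : ℝ}
    (hM : ∀ x y, ‖fderiv ℝ u x - fderiv ℝ u y‖ ≤ M * ‖x - y‖) (x z : EE) :
    |u (x + z) + u (x - z) - 2 * u x| ≤ M * ‖z‖ ^ 2 := by
  have hd : Differentiable ℝ u := hu.differentiable (by norm_num)
  have hb : ∀ y ∈ (univ : Set EE), ‖fderiv ℝ (fun y => u (y + z) - u y) y‖ ≤ M * ‖z‖ := fun y _ => by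
    rw [fderiv_fun_sub (by fun_prop) (by fun_prop), fderiv_comp_add_right]
    simpa using hM (y + z) y
  have := convex_univ.norm_image_sub_le_of_norm_fderiv_le (𝕜 := ℝ)
    (f := fun y => u (y + z) - u y) (fun y _ => by fun_prop)
    hb (mem_univ (x - z)) (mem_univ x)
  simp only [sub_add_cancel, sub_sub_cancel, Real.norm_eq_abs] at this
  calc _ = |u (x + z) - u x - (u x - u (x - z))| := by congr 1; ring
    _ ≤ _ := this
    _ = _ := by ring


section geometry
variable {u : EE → ℝ} {d : ℝ}

lemma geo_local (hu : ContDiff ℝ 3 u) (hd : 0 < d)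
    (H : ∀ x y : EE, ‖y - x‖ < d → ‖gradient u x‖ * ‖gradient u y‖ = inner ℝ (gradient u x) (gradient u y))
    {x τ : EE} (hx : gradient u x ≠ 0) (hτ : inner ℝ (gradient u x) τ = 0) (hτd : ‖τ‖ < d) :
    gradient u (x + τ) = gradient u x := by
  have hdu : Differentiable ℝ u := hu.differentiable (by norm_num)
  have hz : ∀ y, ‖y - x‖ < d → fderiv ℝ u y τ = 0 := by
    intro y hy
    have h1 := (inner_eq_norm_mul_iff_real).1 (H x y hy).symm
    rw [← grad_inner]
    have h2 : ‖gradient u x‖ * inner ℝ (gradient u y) τ = 0 := by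
      rw [← real_inner_smul_left, ← h1, real_inner_smul_left, hτ, mul_zero]
    exact (mul_eq_zero.1 h2).resolve_left (norm_ne_zero_iff.2 hx)
  have hev : (fun y => u (y + τ)) =ᶠ[𝓝 x] u := by
    have hp : 0 < d - ‖τ‖ := by linarith
    filter_upwards [Metric.ball_mem_nhds x hp] with y hy
    rw [mem_ball_iff_norm] at hy
    have hcv : Convex ℝ (ball x d) := convex_ball x d
    have hline : ∀ t ∈ Icc (0:ℝ) 1, HasDerivWithinAt (fun t : ℝ => u (y + t • τ)) 0 (Icc 0 1) t := by
      intro t ht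
      have h1 : HasDerivAt (fun t : ℝ => y + t • τ) τ t := by
        simpa using ((hasDerivAt_id t).smul_const τ).const_add y
      have h2 := (hdu (y + t • τ)).hasFDerivAt.comp_hasDerivAt t h1
      rw [hz] at h2
      · exact h2.hasDerivWithinAt
      · calc ‖y + t • τ - x‖ = ‖(y - x) + t • τ‖ := by congr 1; abel
          _ ≤ ‖y - x‖ + ‖t • τ‖ := norm_add_le _ _
          _ ≤ ‖y - x‖ + ‖τ‖ := by
            rw [norm_smul, Real.norm_eq_abs, abs_of_nonneg ht.1]
            nlinarith [norm_nonneg τ, ht.2]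
          _ < d := by linarith
    have := (convex_Icc (0:ℝ) 1).norm_image_sub_le_of_norm_hasDerivWithin_le (C := 0) hline
      (by simp) (left_mem_Icc.2 zero_le_one) (right_mem_Icc.2 zero_le_one)
    simp only [one_smul, zero_smul, add_zero, zero_mul, norm_le_zero_iff] at this
    linarith
  have := hev.fderiv_eq (𝕜 := ℝ)
  rw [fderiv_comp_add_right] at this
  unfold gradient
  rw [this]

lemma geo_global (hu : ContDiff ℝ 3 u) (hd : 0 < d)
    (H : ∀ x y : EE, ‖y - x‖ < d → ‖gradient u x‖ * ‖gradient u y‖ = inner ℝ (gradient u x) (gradient u y))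
    {x τ : EE} (hx : gradient u x ≠ 0) (hτ : inner ℝ (gradient u x) τ = 0) :
    gradient u (x + τ) = gradient u x := by
  obtain ⟨N, hN⟩ := exists_nat_gt (‖τ‖ / d)
  have hN0 : 0 < (N : ℝ) := lt_of_le_of_lt (by positivity) hN
  set s : EE := (1 / (N:ℝ)) • τ with hs
  have hsn : ‖s‖ < d := by
    rw [hs, norm_smul, Real.norm_eq_abs, abs_of_pos (by positivity)]
    rw [div_lt_iff₀ hd] at hN
    rw [one_div, inv_mul_lt_iff₀ hN0]; exact hN
  have hsi : inner ℝ (gradient u x) s = 0 := by rw [hs, real_inner_smul_right, hτ, mul_zero]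
  have key : ∀ k : ℕ, gradient u (x + (k:ℝ) • s) = gradient u x := by
    intro k
    induction k with
    | zero => simp
    | succ k ih =>
      have : x + ((k+1 : ℕ):ℝ) • s = (x + (k:ℝ) • s) + s := by push_cast; rw [add_smul, one_smul]; abel
      rw [this, geo_local hu hd H (by rwa [ih]) (by rwa [ih]) hsn, ih]
  have := key N
  rwa [hs, smul_smul, mul_one_div_cancel hN0.ne', one_smul] at this

lemma inner2 (a b : EE) : inner ℝ a b = a 0 * b 0 + a 1 * b 1 := by
  rw [PiLp.inner_apply]; simp; ring

lemma geo_final (hu : ContDiff ℝ 3 u) (hd : 0 < d)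
    (H : ∀ x y : EE, ‖y - x‖ < d → ‖gradient u x‖ * ‖gradient u y‖ = inner ℝ (gradient u x) (gradient u y)) :
    ∃ e : EE, ‖e‖ = 1 ∧ ∃ g : ℝ → ℝ, ∀ x, u x = g (@inner ℝ _ _ e x) := by
  have hdu : Differentiable ℝ u := hu.differentiable (by norm_num)
  have hdet : ∀ x y, gradient u x 0 * gradient u y 1 - gradient u x 1 * gradient u y 0 = 0 := by
    intro x y
    by_contra hne
    set a := gradient u x with ha
    set b := gradient u y with hb
    have hx : a ≠ 0 := by rintro h; apply hne; rw [h]; simp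
    have hy : b ≠ 0 := by rintro h; apply hne; rw [h]; simp
    set D := a 0 * b 1 - a 1 * b 0 with hD
    set A := a 0 * x 0 + a 1 * x 1 with hA
    set B := b 0 * y 0 + b 1 * y 1 with hB
    set q : EE := !₂[(A * b 1 - a 1 * B) / D, (a 0 * B - A * b 0) / D] with hq
    have q0 : q 0 = (A * b 1 - a 1 * B) / D := by simp [hq]
    have q1 : q 1 = (a 0 * B - A * b 0) / D := by simp [hq]
    have e1 : gradient u q = a := by
      have := geo_global hu hd H (x := x) (τ := q - x) hx (by
        rw [inner2, ← ha]; simp only [PiLp.sub_apply]; rw [q0, q1]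
        field_simp; rw [hA, hD]; ring)
      simpa using this
    have e2 : gradient u q = b := by
      have := geo_global hu hd H (x := y) (τ := q - y) hy (by
        rw [inner2, ← hb]; simp only [PiLp.sub_apply]; rw [q0, q1]
        field_simp; rw [hB, hD]; ring)
      simpa using this
    apply hne
    rw [hD, ← e1, e2]; ring
  have main : ∀ e : EE, ‖e‖ = 1 → (∀ y, e 0 * gradient u y 1 - e 1 * gradient u y 0 = 0) →
      ∃ e : EE, ‖e‖ = 1 ∧ ∃ g : ℝ → ℝ, ∀ x, u x = g (@inner ℝ _ _ e x) := by
    intro e he hpar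
    refine ⟨e, he, fun t => u (t • e), fun x => ?_⟩
    have he2 : e 0 ^ 2 + e 1 ^ 2 = 1 := by
      have := EuclideanSpace.real_norm_sq_eq e
      rw [he] at this; simpa using this.symm
    set y : EE := (inner ℝ e x) • e with hy
    have hder : ∀ t : ℝ, HasDerivAt (fun t : ℝ => u (y + t • (x - y))) 0 t := by
      intro t
      have h1 : HasDerivAt (fun t : ℝ => y + t • (x - y)) (x - y) t := by
        simpa using ((hasDerivAt_id t).smul_const (x - y)).const_add y
      have h2 := (hdu (y + t • (x - y))).hasFDerivAt.comp_hasDerivAt t h1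
      have h3 : fderiv ℝ u (y + t • (x - y)) (x - y) = 0 := by
        rw [← grad_inner, inner2]
        have h4 := hpar (y + t • (x - y))
        set v := gradient u (y + t • (x - y))
        have y0 : y 0 = (e 0 * x 0 + e 1 * x 1) * e 0 := by rw [hy, inner2]; simp
        have y1 : y 1 = (e 0 * x 0 + e 1 * x 1) * e 1 := by rw [hy, inner2]; simp
        simp only [PiLp.sub_apply]
        rw [y0, y1]
        have : v 0 * (x 0 - (e 0 * x 0 + e 1 * x 1) * e 0) + v 1 * (x 1 - (e 0 * x 0 + e 1 * x 1) * e 1)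
          = (e 0 * v 1 - e 1 * v 0) * (e 0 * x 1 - e 1 * x 0) + (1 - (e 0 ^ 2 + e 1 ^ 2)) * (v 0 * x 0 + v 1 * x 1) := by ring
        rw [this, h4, he2]; ring
      rw [h3] at h2
      exact h2
    have := is_const_of_deriv_eq_zero (f := fun t : ℝ => u (y + t • (x - y)))
      (fun t => (hder t).differentiableAt) (fun t => (hder t).deriv) 1 0
    simpa using this
  by_cases hall : ∀ x, gradient u x = 0
  · refine main (be 0) (norm_be 0) fun y => by simp [hall]
  · push Not at hall
    obtain ⟨x, hx⟩ := hall
    have hn : ‖gradient u x‖ ≠ 0 := norm_ne_zero_iff.2 hx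
    refine main ((‖gradient u x‖)⁻¹ • gradient u x) ?_ fun y => ?_
    · rw [norm_smul, norm_inv, norm_norm, inv_mul_cancel₀ hn]
    · have := hdet x y
      simp only [PiLp.smul_apply, smul_eq_mul]
      linear_combination (‖gradient u x‖)⁻¹ * this

end geometry


/-- Basic properties of the truncated kernel. -/
structure Ker (J : EE → ℝ) (d : ℝ) : Prop where
  meas : Measurable J
  nonneg : ∀ z, z ≠ 0 → 0 ≤ J z
  even : ∀ z, J (-z) = J z
  pos : 0 < d
  far : ∀ z, d < ‖z‖ → J z = 0
  int : Integrable (fun z => ‖z‖ ^ 2 * J z)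

lemma Ker.sq_nonneg {J : EE → ℝ} {d : ℝ} (hJ : Ker J d) (z : EE) : 0 ≤ ‖z‖ ^ 2 * J z := by
  by_cases hz : z = 0
  · simp [hz]
  · exact mul_nonneg (by positivity) (hJ.nonneg z hz)

lemma ker_mk (J : EE → ℝ) (hJmeas : Measurable J)
    (hJnonneg : ∀ z, z ≠ 0 → 0 ≤ J z) (hJeven : ∀ z, z ≠ 0 → J (-z) = J z)
    (d Lam α : ℝ) (hd : 0 < d) (hα2 : α < 2)
    (hJup : ∀ z, z ≠ 0 → J z ≤ Lam * ‖z‖ ^ (-(2:ℝ) - α) * (if ‖z‖ ≤ d then 1 else 0)) :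
    Ker J d := by
  have far : ∀ z, d < ‖z‖ → J z = 0 := by
    intro z hz
    have h0 : z ≠ 0 := by rintro rfl; simp at hz; linarith
    have := hJup z h0
    rw [if_neg (not_le.2 hz), mul_zero] at this
    exact le_antisymm this (hJnonneg z h0)
  refine ⟨hJmeas, hJnonneg, ?_, hd, far, ?_⟩
  · intro z
    by_cases hz : z = 0
    · simp [hz]
    · exact hJeven z hz
  · have hm : Measurable (fun z : EE => ‖z‖ ^ 2 * J z) := by fun_prop
    have h := integrableOn_ball_of_norm_le_rpow (μ := (volume : Measure EE)) (E := EE) (by simp) (f := fun z : EE => ‖z‖ ^ 2 * J z)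
      (C := |Lam|) (α := α) (r := d + 1) (by simpa using hα2) (by
        filter_upwards [ae_restrict_of_ae (compl_mem_ae_iff.2 (measure_singleton (0 : EE)))] with z hz
        have h0 : z ≠ 0 := hz
        have hn : 0 < ‖z‖ := norm_pos_iff.2 h0
        rw [Real.norm_eq_abs, abs_of_nonneg (mul_nonneg (by positivity) (hJnonneg z h0))]
        have h1 : J z ≤ |Lam| * ‖z‖ ^ (-(2:ℝ) - α) := by
          refine (hJup z h0).trans ?_
          have : 0 ≤ ‖z‖ ^ (-(2:ℝ) - α) := by positivity
          split_ifs
          · rw [mul_one]; gcongr; exact le_abs_self _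
          · rw [mul_zero]; positivity
        calc ‖z‖ ^ 2 * J z ≤ ‖z‖ ^ 2 * (|Lam| * ‖z‖ ^ (-(2:ℝ) - α)) := by gcongr
          _ = |Lam| * (‖z‖ ^ (2:ℝ) * ‖z‖ ^ (-(2:ℝ) - α)) := by
            rw [Real.rpow_ofNat]; ring
          _ = |Lam| * ‖z‖ ^ (-α) := by rw [← Real.rpow_add hn]; congr 2; ring)
      hm.aestronglyMeasurable
    refine (integrableOn_iff_integrable_of_support_subset ?_).1 h
    intro z hz
    rw [mem_ball_zero_iff]
    by_contra hlt
    apply hz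
    simp only
    rw [far z (by linarith), mul_zero]

lemma pv_formula {J : EE → ℝ} {d : ℝ} (hJ : Ker J d) {u : EE → ℝ} (huc : Continuous u) {M : ℝ}
    (hM : ∀ x, |u x| ≤ M) (h2 : ∀ x z, |u (x + z) + u (x - z) - 2 * u x| ≤ M * ‖z‖ ^ 2)
    (x : EE) {l : ℝ} (hl : HasPV J u x l) :
    l = (1 / 2) * ∫ z, J z * (u (x + z) + u (x - z) - 2 * u x) := by
  have hJm := hJ.meas
  have hum := huc.measurable
  have hM0 : 0 ≤ M := (abs_nonneg _).trans (hM 0)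
  have hms : ∀ ε : ℝ, MeasurableSet {z : EE | ε < ‖z‖} := fun ε =>
    measurableSet_lt measurable_const measurable_norm
  have heq : ∀ ε > 0, truncI J u x ε = (1 / 2) *
      ∫ z, {z : EE | ε < ‖z‖}.indicator (fun z => J z * (u (x + z) + u (x - z) - 2 * u x)) z := by
    intro ε hε
    have hgint : ∀ g : EE → ℝ, Measurable g → (∀ z, |g z| ≤ 2 * M) →
        Integrable ({z : EE | ε < ‖z‖}.indicator (fun z => J z * g z)) := by
      intro g hg hb
      refine Integrable.mono' (hJ.int.const_mul (2 * M / ε ^ 2))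
        (((hJm.mul hg).indicator (hms ε)).aestronglyMeasurable) (Eventually.of_forall fun z => ?_)
      by_cases hz : ε < ‖z‖
      · rw [indicator_of_mem (by exact hz)]
        have h0 : z ≠ 0 := norm_pos_iff.1 (hε.trans hz)
        rw [norm_mul, Real.norm_eq_abs, Real.norm_eq_abs, abs_of_nonneg (hJ.nonneg z h0)]
        have hJz := hJ.nonneg z h0
        have h1 : 1 ≤ ‖z‖ ^ 2 / ε ^ 2 := by
          rw [le_div_iff₀ (by positivity), one_mul]; gcongr
        calc J z * |g z| ≤ J z * (2 * M) := by gcongr; exact hb z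
          _ = 1 * (2 * M * J z) := by ring
          _ ≤ (‖z‖ ^ 2 / ε ^ 2) * (2 * M * J z) := by gcongr
          _ = _ := by ring
      · rw [indicator_of_notMem (by exact hz)]
        simp only [norm_zero]
        exact mul_nonneg (by positivity) (hJ.sq_nonneg z)
    have e1 : truncI J u x ε = ∫ z, {z : EE | ε < ‖z‖}.indicator (fun z => J z * (u (x - z) - u x)) z := by
      unfold truncI
      rw [← integral_indicator (measurableSet_lt measurable_const (by fun_prop)),
        ← integral_sub_left_eq_self _ volume x]
      congr 1
      ext z
      by_cases hz : ε < ‖z‖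
      · rw [indicator_of_mem (by simpa [dist_eq_norm] using hz), indicator_of_mem (by exact hz)]
        rw [sub_sub_cancel]; ring
      · rw [indicator_of_notMem (by simpa [dist_eq_norm] using hz), indicator_of_notMem (by exact hz)]
    have e2 : truncI J u x ε = ∫ z, {z : EE | ε < ‖z‖}.indicator (fun z => J z * (u (x + z) - u x)) z := by
      rw [e1, ← integral_neg_eq_self]
      congr 1
      ext z
      by_cases hz : ε < ‖z‖
      · rw [indicator_of_mem (by simpa using hz), indicator_of_mem (by exact hz)]
        rw [sub_neg_eq_add, hJ.even]
      · rw [indicator_of_notMem (by simpa using hz), indicator_of_notMem (by exact hz)]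
    have hb : ∀ a b, |u a - u b| ≤ 2 * M := fun a b => by
      calc |u a - u b| ≤ |u a| + |u b| := abs_sub _ _
        _ ≤ _ := by linarith [hM a, hM b]
    have e3 := integral_add (hgint (fun z => u (x - z) - u x) (by fun_prop) (fun z => hb _ _))
      (hgint (fun z => u (x + z) - u x) (by fun_prop) (fun z => hb _ _))
    rw [← e1, ← e2] at e3
    have e4 : (fun z => {z : EE | ε < ‖z‖}.indicator (fun z => J z * (u (x + z) + u (x - z) - 2 * u x)) z)
      = fun z => {z : EE | ε < ‖z‖}.indicator (fun z => J z * (u (x - z) - u x)) z +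
        {z : EE | ε < ‖z‖}.indicator (fun z => J z * (u (x + z) - u x)) z := by
      ext z
      by_cases hz : ε < ‖z‖
      · simp only [indicator_of_mem (show z ∈ {z : EE | ε < ‖z‖} from hz)]; ring
      · simp only [indicator_of_notMem (show z ∉ {z : EE | ε < ‖z‖} from hz)]; ring
    rw [e4, e3]; ring
  have hlim : Tendsto (fun ε : ℝ => ∫ z, {z : EE | ε < ‖z‖}.indicator
      (fun z => J z * (u (x + z) + u (x - z) - 2 * u x)) z) (𝓝[>] 0)
      (𝓝 (∫ z, J z * (u (x + z) + u (x - z) - 2 * u x))) := by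
    refine tendsto_integral_filter_of_dominated_convergence (fun z => M * (‖z‖ ^ 2 * J z)) ?_ ?_
      (hJ.int.const_mul M) ?_
    · refine Eventually.of_forall fun ε => ?_
      exact (Measurable.indicator (by fun_prop) (hms ε)).aestronglyMeasurable
    · filter_upwards [self_mem_nhdsWithin] with ε hε
      refine Eventually.of_forall fun z => ?_
      by_cases hz : ε < ‖z‖
      · rw [indicator_of_mem (by exact hz)]
        have h0 : z ≠ 0 := norm_pos_iff.1 (lt_trans hε hz)
        rw [norm_mul, Real.norm_eq_abs, Real.norm_eq_abs, abs_of_nonneg (hJ.nonneg z h0)]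
        have hJz := hJ.nonneg z h0
        calc _ ≤ J z * (M * ‖z‖ ^ 2) := by gcongr; exact h2 x z
          _ = _ := by ring
      · rw [indicator_of_notMem (by exact hz)]
        simp only [norm_zero]
        exact mul_nonneg hM0 (hJ.sq_nonneg z)
    · refine Eventually.of_forall fun z => ?_
      by_cases h0 : z = 0
      · subst h0
        have : (fun ε : ℝ => {z : EE | ε < ‖z‖}.indicator
          (fun z => J z * (u (x + z) + u (x - z) - 2 * u x)) 0) = fun _ => J 0 * (u (x + 0) + u (x - 0) - 2 * u x) := by
          ext ε
          rw [indicator_apply]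
          split_ifs
          · rfl
          · simp; right; ring
        rw [this]; exact tendsto_const_nhds
      · refine tendsto_const_nhds.congr' ?_
        have : ∀ᶠ ε : ℝ in 𝓝[>] 0, ε < ‖z‖ :=
          nhdsWithin_le_nhds (Iio_mem_nhds (norm_pos_iff.2 h0))
        filter_upwards [this] with ε hε
        rw [indicator_of_mem (by exact hε)]
  have hlim2 : Tendsto (fun ε => truncI J u x ε) (𝓝[>] 0)
      (𝓝 ((1 / 2) * ∫ z, J z * (u (x + z) + u (x - z) - 2 * u x))) := by
    refine (hlim.const_mul (1 / 2)).congr' ?_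
    filter_upwards [self_mem_nhdsWithin] with ε hε
    exact (heq ε hε).symm
  exact tendsto_nhds_unique hl hlim2

/-- integrability on the product -/
lemma prod_int {J : EE → ℝ} {d : ℝ} (hJ : Ker J d) {g : EE × EE → ℝ} (hg : Continuous g) {K R : ℝ}
    (hb : ∀ x z, |g (x, z)| ≤ K * ‖z‖ ^ 2) (hs : ∀ x z, ‖z‖ ≤ d → R < ‖x‖ → g (x, z) = 0) :
    Integrable (fun q : EE × EE => J q.2 * g q) := by
  have hJm := hJ.meas
  have hgm := hg.measurable
  have hK : Integrable (fun x : EE => (closedBall (0:EE) R).indicator (fun _ => |K|) x) :=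
    (integrable_indicator_iff measurableSet_closedBall).2 (integrableOn_const (by
      exact (measure_closedBall_lt_top).ne))
  have h := hK.mul_prod hJ.int
  refine Integrable.mono' h (by fun_prop) (Eventually.of_forall ?_)
  rintro ⟨x, z⟩
  simp only
  by_cases h0 : z = 0
  · subst h0
    have : g (x, 0) = 0 := by have := hb x 0; simpa using this
    simp [this]
  have hJz := hJ.nonneg z h0
  by_cases hz : ‖z‖ ≤ d
  · by_cases hx : R < ‖x‖
    · rw [hs x z hz hx]
      rw [indicator_of_notMem (by simpa using hx)]; simp
    · rw [indicator_of_mem (by simpa using hx), norm_mul, Real.norm_eq_abs, Real.norm_eq_abs, abs_of_nonneg hJz]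
      calc J z * |g (x, z)| ≤ J z * (|K| * ‖z‖ ^ 2) := by
            gcongr; exact (hb x z).trans (by gcongr; exact le_abs_self _)
        _ = _ := by ring
  · rw [hJ.far z (by linarith)]; simp

/-- Gagliardo form as product integral -/
lemma stab_form {J : EE → ℝ} {d : ℝ} (hJ : Ker J d) {ζ : EE → ℝ} (hc : Continuous ζ) {K R : ℝ}
    (hb : ∀ x z, |ζ (x + z) - ζ x| ≤ K * ‖z‖) (hs : ∀ x, R < ‖x‖ → ζ x = 0) :
    Integrable (fun q : EE × EE => J q.2 * (ζ (q.1 + q.2) - ζ q.1) ^ 2) ∧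
    ∫ x, ∫ y, (ζ x - ζ y) ^ 2 * J (x - y) = ∫ q : EE × EE, J q.2 * (ζ (q.1 + q.2) - ζ q.1) ^ 2 := by
  have hi : Integrable (fun q : EE × EE => J q.2 * (ζ (q.1 + q.2) - ζ q.1) ^ 2) := by
    refine prod_int hJ (g := fun q => (ζ (q.1 + q.2) - ζ q.1) ^ 2) (by fun_prop) (K := K ^ 2) (R := R + d) ?_ ?_
    · intro x z
      rw [abs_pow, ← mul_pow]
      gcongr
      exact hb x z
    · intro x z hz hx
      have h1 : R < ‖x + z‖ := by
        have := norm_sub_norm_le x (-z)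
        rw [norm_neg, sub_neg_eq_add] at this; linarith
      simp only
      rw [hs _ h1, hs x (by linarith [hJ.pos])]; simp
  refine ⟨hi, ?_⟩
  rw [Measure.volume_eq_prod] at hi ⊢
  rw [integral_prod _ hi]
  congr 1
  ext x
  rw [← integral_add_left_eq_self _ x]
  congr 1
  ext z
  simp only
  rw [show x - (x + z) = -z by abel, hJ.even]; ring


lemma hcs_trans {w : EE → ℝ} (hw : HasCompactSupport w) (z : EE) :
    HasCompactSupport (fun x => w (x + z)) :=
  hw.comp_homeomorph (Homeomorph.addRight z)

lemma disc_ibp {v w : EE → ℝ} (hv : Continuous v) (hw : Continuous w) (hc : HasCompactSupport w) (z : EE) :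
    ∫ x, (v (x + z) + v (x - z) - 2 * v x) * w x = - ∫ x, (v (x + z) - v x) * (w (x + z) - w x) := by
  have hcz := hcs_trans hc z
  have i1 : Integrable (fun x => v x * w x) :=
    Continuous.integrable_of_hasCompactSupport (by fun_prop) hc.mul_left
  have i2 : Integrable (fun x => v (x + z) * w x) :=
    Continuous.integrable_of_hasCompactSupport (by fun_prop) hc.mul_left
  have i3 : Integrable (fun x => v (x - z) * w x) :=
    Continuous.integrable_of_hasCompactSupport (by fun_prop) hc.mul_left
  have i4 : Integrable (fun x => v (x + z) * w (x + z)) :=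
    Continuous.integrable_of_hasCompactSupport (by fun_prop) hcz.mul_left
  have i5 : Integrable (fun x => v x * w (x + z)) :=
    Continuous.integrable_of_hasCompactSupport (by fun_prop) hcz.mul_left
  have e4 : ∫ x, v (x + z) * w (x + z) = ∫ x, v x * w x :=
    integral_add_right_eq_self (fun x => v x * w x) z
  have e5 : ∫ x, v x * w (x + z) = ∫ x, v (x - z) * w x := by
    have := integral_add_right_eq_self (μ := volume) (fun x => v (x - z) * w x) z
    simpa using this
  have L : ∫ x, (v (x + z) + v (x - z) - 2 * v x) * w x =
      (∫ x, v (x + z) * w x) + (∫ x, v (x - z) * w x) - 2 * ∫ x, v x * w x := by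
    rw [← integral_const_mul, ← integral_add i2 i3, ← integral_sub (i2.fun_add i3) (i1.const_mul 2)]
    congr 1; ext x; ring
  have Rr : ∫ x, (v (x + z) - v x) * (w (x + z) - w x) =
      (∫ x, v (x + z) * w (x + z)) + (∫ x, v x * w x) - ((∫ x, v (x + z) * w x) + ∫ x, v x * w (x + z)) := by
    rw [← integral_add i4 i1, ← integral_add i2 i5, ← integral_sub (i4.fun_add i1) (i2.fun_add i5)]
    congr 1; ext x; ring
  rw [L, Rr, e4, e5]; ring

lemma pd_second {u : EE → ℝ} (hu : ContDiff ℝ 1 u) (i : Fin 2) (x z : EE) :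
    pd i (fun x => u (x + z) + u (x - z) - 2 * u x) x
      = pd i u (x + z) + pd i u (x - z) - 2 * pd i u x := by
  have hd : Differentiable ℝ u := hu.differentiable (by norm_num)
  unfold pd
  rw [fderiv_fun_sub (by fun_prop) (by fun_prop), fderiv_fun_add (by fun_prop) (by fun_prop),
    fderiv_comp_add_right, fderiv_comp_sub, fderiv_const_mul (by fun_prop)]
  simp

lemma lip_of_hcs {w : EE → ℝ} (hw : ContDiff ℝ 1 w) (hc : HasCompactSupport w) :
    ∃ K, 0 ≤ K ∧ ∀ x z, |w (x + z) - w x| ≤ K * ‖z‖ := by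
  obtain ⟨K, hK⟩ := hw.lipschitzWith_of_hasCompactSupport hc (by norm_num)
  refine ⟨K, K.2, fun x z => ?_⟩
  have := hK.dist_le_mul (x + z) x
  simpa [dist_eq_norm] using this

lemma pd_lip {u : EE → ℝ} {M : ℝ}
    (hM : ∀ x y, ‖fderiv ℝ u x - fderiv ℝ u y‖ ≤ M * ‖x - y‖) (i : Fin 2) (x z : EE) :
    |pd i u (x + z) - pd i u x| ≤ M * ‖z‖ := by
  have h := hM (x + z) x
  rw [add_sub_cancel_left] at h
  unfold pd
  rw [← _root_.sub_apply, ← Real.norm_eq_abs]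
  refine (ContinuousLinearMap.le_opNorm _ _).trans ?_
  rw [norm_be, mul_one]; exact h

lemma hcs_bound {w : EE → ℝ} (hc : HasCompactSupport w) : ∃ R, ∀ x, R < ‖x‖ → w x = 0 := by
  obtain ⟨R, hR⟩ := hc.isBounded.subset_closedBall 0
  refine ⟨R, fun x hx => ?_⟩
  by_contra h
  have := hR (subset_tsupport _ h)
  rw [mem_closedBall_zero_iff] at this
  linarith

lemma lin_weak {J : EE → ℝ} {d : ℝ} (hJ : Ker J d) {c : ℝ} (hc : 0 < c) {f : ℝ → ℝ} (hf : ContDiff ℝ 1 f)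
    {u : EE → ℝ} (hu : ContDiff ℝ 3 u) {M : ℝ} (hM0 : ∀ x, |u x| ≤ M)
    (hM : ∀ x y, ‖fderiv ℝ u x - fderiv ℝ u y‖ ≤ M * ‖x - y‖)
    {Lu : EE → ℝ} (hLu : ∀ x, HasPV J u x (Lu x))
    (heq : ∀ x, lap u x + c * Lu x + f (u x) = 0) (i : Fin 2) {w : EE → ℝ} (hw : ContDiff ℝ 2 w)
    (hwc : HasCompactSupport w) :
    Integrable (fun q : EE × EE => J q.2 * ((pd i u (q.1 + q.2) - pd i u q.1) * (w (q.1 + q.2) - w q.1))) ∧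
    ∫ x, deriv f (u x) * (pd i u x * w x) =
      (∫ x, (pd 0 (pd i u) x * pd 0 w x + pd 1 (pd i u) x * pd 1 w x)) + (c / 2) *
      ∫ q : EE × EE, J q.2 * ((pd i u (q.1 + q.2) - pd i u q.1) * (w (q.1 + q.2) - w q.1)) := by
  have hu2 : ContDiff ℝ 2 u := hu.of_le (by norm_num)
  have hu1 : ContDiff ℝ 1 u := hu.of_le (by norm_num)
  have hw1 : ContDiff ℝ 1 w := hw.of_le (by norm_num)
  have huc := hu.continuous
  have hwcont := hw.continuous
  have hMn : 0 ≤ M := (abs_nonneg _).trans (hM0 0)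
  have hv : ∀ j, ContDiff ℝ 2 (pd j u) := fun j => pd_contDiff (m := 2) (n := 3) j hu le_rfl
  have hv1 : ∀ j, ContDiff ℝ 1 (pd j u) := fun j => (hv j).of_le (by norm_num)
  have hvv : ∀ j k, ContDiff ℝ 1 (pd j (pd k u)) := fun j k => pd_contDiff (m := 1) (n := 2) j (hv k) le_rfl
  have hφ : ∀ j, ContDiff ℝ 1 (pd j w) := fun j => pd_contDiff (m := 1) (n := 2) j hw le_rfl
  have hφc : ∀ j, HasCompactSupport (pd j w) := fun j => pd_hcs j hwc
  have hvcont := (hv i).continuous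
  have hφcont := (hφ i).continuous
  obtain ⟨K, hK0, hK⟩ := lip_of_hcs hw1 hwc
  obtain ⟨R, hR⟩ := hcs_bound hwc
  obtain ⟨R', hR'⟩ := hcs_bound (hφc i)
  -- integrability
  have hI : Integrable (fun q : EE × EE => J q.2 * ((pd i u (q.1 + q.2) - pd i u q.1) * (w (q.1 + q.2) - w q.1))) := by
    refine prod_int hJ (g := fun q => (pd i u (q.1 + q.2) - pd i u q.1) * (w (q.1 + q.2) - w q.1))
      (by fun_prop) (K := M * K) (R := R + d) ?_ ?_
    · intro x z
      rw [abs_mul]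
      calc _ ≤ (M * ‖z‖) * (K * ‖z‖) :=
            mul_le_mul (pd_lip hM i x z) (hK x z) (abs_nonneg _) (by positivity)
        _ = _ := by ring
    · intro x z hz hx
      have h1 : R < ‖x + z‖ := by
        have := norm_sub_norm_le x (-z)
        rw [norm_neg, sub_neg_eq_add] at this; linarith
      simp only
      rw [hR _ h1, hR x (by linarith [hJ.pos])]; simp
  refine ⟨hI, ?_⟩
  -- step 1
  have s1 : ∫ x, deriv f (u x) * (pd i u x * w x) = - ∫ x, f (u x) * pd i w x := by
    rw [ibp i (g := fun x => f (u x)) (hf.comp hu1) hw1 hwc, neg_neg]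
    congr 1
    ext x
    have : pd i (fun x => f (u x)) x = deriv f (u x) * pd i u x := by
      unfold pd
      have h1 := ((hf.differentiable (by norm_num)) (u x)).hasDerivAt.comp_hasFDerivAt x
        ((hu1.differentiable (by norm_num)) x).hasFDerivAt
      have h2 := h1.fderiv
      rw [Function.comp_def] at h2
      rw [h2]; simp
    rw [this]; ring
  have hLuc : Lu = fun x => -(pd 0 (pd 0 u) x + pd 1 (pd 1 u) x + f (u x)) / c := by
    ext x
    have := heq x
    rw [lap_eq hu2, Fin.sum_univ_two] at this
    field_simp; linarith
  have c0 := (hvv 0 0).continuous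
  have c1 := (hvv 1 1).continuous
  have hfc := hf.continuous
  have hLucont : Continuous Lu := by rw [hLuc]; fun_prop
  have iL : Integrable (fun x => Lu x * pd i w x) :=
    Continuous.integrable_of_hasCompactSupport (by fun_prop) (hφc i).mul_left
  have i0 : ∀ j k, Integrable (fun x => pd j (pd k u) x * pd i w x) := fun j k =>
    Continuous.integrable_of_hasCompactSupport ((hvv j k).continuous.mul hφcont) (hφc i).mul_left
  have i0' : ∀ j k l, Integrable (fun x => pd j (pd k u) x * pd l w x) := fun j k l =>
    Continuous.integrable_of_hasCompactSupport ((hvv j k).continuous.mul (hφ l).continuous) (hφc l).mul_left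
  have s2 : - ∫ x, f (u x) * pd i w x = (∫ x, pd 0 (pd 0 u) x * pd i w x) + (∫ x, pd 1 (pd 1 u) x * pd i w x)
      + c * ∫ x, Lu x * pd i w x := by
    rw [← integral_const_mul, ← integral_neg, ← integral_add (i0 0 0) (i0 1 1),
      ← integral_add ((i0 0 0).fun_add (i0 1 1)) (iL.const_mul c)]
    congr 1; ext x
    have := heq x
    rw [lap_eq hu2, Fin.sum_univ_two] at this
    linear_combination (-pd i w x) * this
  have s3 : ∀ j, ∫ x, pd j (pd j u) x * pd i w x = ∫ x, pd j (pd i u) x * pd j w x := by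
    intro j
    have a1 := ibp j (hv1 j) (hφ i) (hφc i)
    have a2 := ibp i (hv1 j) (hφ j) (hφc j)
    have a3 : ∫ x, pd j u x * pd j (pd i w) x = ∫ x, pd j u x * pd i (pd j w) x := by
      congr 1; ext x; rw [pd_comm hw]
    have a4 : ∫ x, pd i (pd j u) x * pd j w x = ∫ x, pd j (pd i u) x * pd j w x := by
      congr 1; ext x; rw [pd_comm hu2]
    linarith
  have s4 : ∫ x, Lu x * pd i w x = (1 / 2) *
      ∫ q : EE × EE, J q.2 * ((pd i u (q.1 + q.2) - pd i u q.1) * (w (q.1 + q.2) - w q.1)) := by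
    have hpv : ∀ x, Lu x = (1 / 2) * ∫ z, J z * (u (x + z) + u (x - z) - 2 * u x) := fun x =>
      pv_formula hJ huc hM0 (second_diff hu hM) x (hLu x)
    have hP : Integrable (fun q : EE × EE => J q.2 * ((u (q.1 + q.2) + u (q.1 - q.2) - 2 * u q.1) * pd i w q.1)) := by
      obtain ⟨B, hB⟩ := hφcont.bounded_above_of_compact_support (hφc i)
      refine prod_int hJ (g := fun q => (u (q.1 + q.2) + u (q.1 - q.2) - 2 * u q.1) * pd i w q.1)
        (by fun_prop) (K := M * B) (R := R') ?_ ?_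
      · intro x z
        rw [abs_mul]
        calc _ ≤ (M * ‖z‖ ^ 2) * B :=
              mul_le_mul (second_diff hu hM x z) (hB x) (abs_nonneg _) (by positivity)
          _ = _ := by ring
      · intro x z _ hx
        simp only
        rw [hR' x hx, mul_zero]
    rw [Measure.volume_eq_prod] at hP hI ⊢
    rw [integral_prod_symm _ hI]
    have e1 : ∫ x, Lu x * pd i w x = (1 / 2) * ∫ x, ∫ z, J z * ((u (x + z) + u (x - z) - 2 * u x) * pd i w x) := by
      rw [← integral_const_mul]
      congr 1; ext x
      rw [hpv x, mul_assoc, ← integral_mul_const]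
      congr 2; ext z; ring
    rw [e1]
    congr 1
    have e2 := integral_prod _ hP
    have e3 := integral_prod_symm _ hP
    simp only at e2 e3 ⊢
    rw [← e2, e3]
    congr 1; ext z
    rw [integral_const_mul, integral_const_mul]
    congr 1
    rw [ibp i (g := fun x => u (x + z) + u (x - z) - 2 * u x) (by fun_prop) hw1 hwc]
    simp_rw [pd_second hu1]
    rw [disc_ibp hvcont hwcont hwc, neg_neg]
  rw [s1, s2, s3, s3, s4, integral_add (i0' _ _ _) (i0' _ _ _)]
  ring


lemma pd_mul {g h : EE → ℝ} {x : EE} (hg : DifferentiableAt ℝ g x) (hh : DifferentiableAt ℝ h x) (j : Fin 2) :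
    pd j (fun x => g x * h x) x = g x * pd j h x + h x * pd j g x := by
  unfold pd
  rw [fderiv_fun_mul hg hh]; simp

lemma pd_add {g h : EE → ℝ} {x : EE} (hg : DifferentiableAt ℝ g x) (hh : DifferentiableAt ℝ h x) (j : Fin 2) :
    pd j (fun x => g x + h x) x = pd j g x + pd j h x := by
  unfold pd
  rw [fderiv_fun_add hg hh]; simp

lemma grad_cont {u : EE → ℝ} (hu : ContDiff ℝ 3 u) : Continuous (gradient u) := by
  unfold gradient
  exact (LinearIsometryEquiv.continuous _).comp (hu.continuous_fderiv (by norm_num))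

lemma fun_sub_int {X : Type*} [MeasurableSpace X] {μ : Measure X} {g h : X → ℝ} (hg : Integrable g μ)
    (hh : Integrable h μ) : Integrable (fun x => g x - h x) μ := hg.sub hh

lemma pnorm_sq (u : EE → ℝ) (x : EE) : ‖gradient u x‖ = √(pd 0 u x ^ 2 + pd 1 u x ^ 2) := by
  rw [← grad_norm_sq, Real.sqrt_sq (norm_nonneg _)]

lemma alg_kato (e e0 e1 p a0 a1 v0 v1 v00 v01 v10 v11 : ℝ) (hp : 0 < p) (hpp : p ^ 2 = v0 ^ 2 + v1 ^ 2)
    (h0 : p * a0 = v0 * v00 + v1 * v10) (h1 : p * a1 = v0 * v01 + v1 * v11) :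
    (p * e0 + e * a0) ^ 2 + (p * e1 + e * a1) ^ 2 ≤
      (v00 * (v0 * (2 * e * e0) + e ^ 2 * v00) + v01 * (v0 * (2 * e * e1) + e ^ 2 * v01))
      + (v10 * (v1 * (2 * e * e0) + e ^ 2 * v10) + v11 * (v1 * (2 * e * e1) + e ^ 2 * v11))
      + p ^ 2 * (e0 ^ 2 + e1 ^ 2) := by
  have k0 : a0 ^ 2 ≤ v00 ^ 2 + v10 ^ 2 := by
    have : p ^ 2 * a0 ^ 2 ≤ p ^ 2 * (v00 ^ 2 + v10 ^ 2) := by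
      rw [← mul_pow, h0, hpp]; nlinarith [sq_nonneg (v0 * v10 - v1 * v00)]
    exact le_of_mul_le_mul_left this (by positivity)
  have k1 : a1 ^ 2 ≤ v01 ^ 2 + v11 ^ 2 := by
    have : p ^ 2 * a1 ^ 2 ≤ p ^ 2 * (v01 ^ 2 + v11 ^ 2) := by
      rw [← mul_pow, h1, hpp]; nlinarith [sq_nonneg (v0 * v11 - v1 * v01)]
    exact le_of_mul_le_mul_left this (by positivity)
  have m0 := mul_le_mul_of_nonneg_left k0 (sq_nonneg e)
  have m1 := mul_le_mul_of_nonneg_left k1 (sq_nonneg e)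
  have : (p * e0 + e * a0) ^ 2 + (p * e1 + e * a1) ^ 2 = p ^ 2 * (e0 ^ 2 + e1 ^ 2) +
      (2 * e * e0 * (p * a0) + 2 * e * e1 * (p * a1)) + (e ^ 2 * a0 ^ 2 + e ^ 2 * a1 ^ 2) := by ring
  rw [this, h0, h1]
  nlinarith

lemma kato {u η : EE → ℝ} (hu : ContDiff ℝ 3 u) (hη : ContDiff ℝ 2 η) (hη0 : ∀ x, 0 ≤ η x) (x : EE) :
    ‖gradient (fun x => ‖gradient u x‖ * η x) x‖ ^ 2 ≤
      (pd 0 (pd 0 u) x * pd 0 (fun x => pd 0 u x * η x ^ 2) x + pd 1 (pd 0 u) x * pd 1 (fun x => pd 0 u x * η x ^ 2) x)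
      + (pd 0 (pd 1 u) x * pd 0 (fun x => pd 1 u x * η x ^ 2) x + pd 1 (pd 1 u) x * pd 1 (fun x => pd 1 u x * η x ^ 2) x)
      + ‖gradient u x‖ ^ 2 * ‖gradient η x‖ ^ 2 := by
  have hv : ∀ j, Differentiable ℝ (pd j u) := fun j =>
    (pd_contDiff (m := 2) (n := 3) j hu le_rfl).differentiable (by norm_num)
  have hηd : Differentiable ℝ η := hη.differentiable (by norm_num)
  have hsq : ∀ j, pd j (fun x => η x ^ 2) x = 2 * η x * pd j η x := by
    intro j
    have : (fun x => η x ^ 2) = fun x => η x * η x := by ext x; ring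
    rw [this, pd_mul (hηd x) (hηd x)]; ring
  have hw : ∀ i j, pd j (fun x => pd i u x * η x ^ 2) x
      = pd i u x * (2 * η x * pd j η x) + η x ^ 2 * pd j (pd i u) x := by
    intro i j
    rw [pd_mul (hv i x) (by fun_prop), hsq]
  by_cases hp : ‖gradient u x‖ = 0
  · have hmin : IsLocalMin (fun x => ‖gradient u x‖ * η x) x := by
      refine Eventually.of_forall fun y => ?_
      simp only
      rw [hp, zero_mul]; exact mul_nonneg (norm_nonneg _) (hη0 y)
    have h0 : gradient (fun x => ‖gradient u x‖ * η x) x = 0 := by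
      have := hmin.fderiv_eq_zero
      rw [gradient, this]; simp
    have hs := grad_norm_sq u x
    rw [hp] at hs
    have v0 : pd 0 u x = 0 := by nlinarith [sq_nonneg (pd 0 u x), sq_nonneg (pd 1 u x)]
    have v1 : pd 1 u x = 0 := by nlinarith [sq_nonneg (pd 0 u x), sq_nonneg (pd 1 u x)]
    rw [h0, hp]
    simp only [hw, v0, v1]
    have : 0 ≤ (η x * pd 0 (pd 0 u) x) ^ 2 + (η x * pd 1 (pd 0 u) x) ^ 2 + (η x * pd 0 (pd 1 u) x) ^ 2
      + (η x * pd 1 (pd 1 u) x) ^ 2 := by positivity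
    simp
    nlinarith
  · have hpos : 0 < ‖gradient u x‖ := lt_of_le_of_ne (norm_nonneg _) (Ne.symm hp)
    have hpd : DifferentiableAt ℝ (fun x => ‖gradient u x‖) x := by
      have : (fun x => ‖gradient u x‖) = fun x => √(pd 0 u x ^ 2 + pd 1 u x ^ 2) := by
        ext x; exact pnorm_sq u x
      rw [this]
      refine DifferentiableAt.sqrt ?_ ?_
      · have h0 := hv 0; have h1 := hv 1; fun_prop
      · rw [← grad_norm_sq]; positivity
    have ha : ∀ j, ‖gradient u x‖ * pd j (fun x => ‖gradient u x‖) x =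
        pd 0 u x * pd j (pd 0 u) x + pd 1 u x * pd j (pd 1 u) x := by
      intro j
      have e : (fun x => ‖gradient u x‖ * ‖gradient u x‖) = fun x => pd 0 u x * pd 0 u x + pd 1 u x * pd 1 u x := by
        ext x; have := grad_norm_sq u x; nlinarith
      have e1 := pd_mul hpd hpd j
      rw [e] at e1
      have e2 : pd j (fun x => pd 0 u x * pd 0 u x + pd 1 u x * pd 1 u x) x
        = pd j (fun x => pd 0 u x * pd 0 u x) x + pd j (fun x => pd 1 u x * pd 1 u x) x := by
        exact pd_add ((hv 0 x).mul (hv 0 x)) ((hv 1 x).mul (hv 1 x)) j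
      rw [e2, pd_mul (hv 0 x) (hv 0 x), pd_mul (hv 1 x) (hv 1 x)] at e1
      linarith
    rw [grad_norm_sq (fun x => ‖gradient u x‖ * η x), pd_mul hpd (hηd x), pd_mul hpd (hηd x), grad_norm_sq η]
    simp only [hw]
    exact alg_kato _ _ _ _ _ _ _ _ _ _ _ _ hpos (grad_norm_sq u x) (ha 0) (ha 1)

lemma poincare {J : EE → ℝ} {d : ℝ} (hJ : Ker J d) {c : ℝ} (hc : 0 < c) {f : ℝ → ℝ} (hf : ContDiff ℝ 1 f)
    {u : EE → ℝ} (hu : ContDiff ℝ 3 u) {M : ℝ} (hM0 : ∀ x, |u x| ≤ M) (hM1 : ∀ x, ‖fderiv ℝ u x‖ ≤ M)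
    (hM : ∀ x y, ‖fderiv ℝ u x - fderiv ℝ u y‖ ≤ M * ‖x - y‖)
    {Lu : EE → ℝ} (hLu : ∀ x, HasPV J u x (Lu x))
    (heq : ∀ x, lap u x + c * Lu x + f (u x) = 0) (hstab : IsStable J c f u)
    {η : EE → ℝ} (hη : ContDiff ℝ 2 η) (hηc : HasCompactSupport η) (hη0 : ∀ x, 0 ≤ η x) :
    Integrable (fun q : EE × EE => J q.2 * ((‖gradient u q.1‖ * ‖gradient u (q.1 + q.2)‖ -
      inner ℝ (gradient u q.1) (gradient u (q.1 + q.2))) * (η q.1 ^ 2 + η (q.1 + q.2) ^ 2))) ∧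
    Integrable (fun q : EE × EE => J q.2 * (‖gradient u q.1‖ * ‖gradient u (q.1 + q.2)‖ *
      (η (q.1 + q.2) - η q.1) ^ 2)) ∧
    c / 2 * ∫ q : EE × EE, J q.2 * ((‖gradient u q.1‖ * ‖gradient u (q.1 + q.2)‖ -
      inner ℝ (gradient u q.1) (gradient u (q.1 + q.2))) * (η q.1 ^ 2 + η (q.1 + q.2) ^ 2)) ≤
    (∫ x, ‖gradient u x‖ ^ 2 * ‖gradient η x‖ ^ 2) +
    c / 2 * ∫ q : EE × EE, J q.2 * (‖gradient u q.1‖ * ‖gradient u (q.1 + q.2)‖ *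
      (η (q.1 + q.2) - η q.1) ^ 2) := by
  have hMn : 0 ≤ M := (abs_nonneg _).trans (hM0 0)
  have hv : ∀ j, ContDiff ℝ 2 (pd j u) := fun j => pd_contDiff (m := 2) (n := 3) j hu le_rfl
  have hw : ∀ j, ContDiff ℝ 2 (fun x => pd j u x * η x ^ 2) := fun j => (hv j).mul (hη.pow 2)
  have hηsq : HasCompactSupport (fun x => η x ^ 2) := by
    have : (fun x => η x ^ 2) = fun x => η x * η x := by ext x; ring
    rw [this]; exact hηc.mul_left
  have hwc : ∀ j, HasCompactSupport (fun x => pd j u x * η x ^ 2) := fun j => hηsq.mul_left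
  obtain ⟨I0, W0⟩ := lin_weak hJ hc hf hu hM0 hM hLu heq 0 (hw 0) (hwc 0)
  obtain ⟨I1, W1⟩ := lin_weak hJ hc hf hu hM0 hM hLu heq 1 (hw 1) (hwc 1)
  have hηcont := hη.continuous
  have hη1 : ContDiff ℝ 1 η := hη.of_le (by norm_num)
  have hvcont : ∀ j, Continuous (pd j u) := fun j => (hv j).continuous
  have hvc0 := hvcont 0
  have hvc1 := hvcont 1
  have hgc := grad_cont hu
  have hpcont : Continuous (fun x => ‖gradient u x‖) := by
    have : (fun x => ‖gradient u x‖) = fun x => √(pd 0 u x ^ 2 + pd 1 u x ^ 2) := by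
      ext x; exact pnorm_sq u x
    rw [this]; fun_prop
  have hpM : ∀ x, ‖gradient u x‖ ≤ M := fun x => by
    have := hM1 x
    unfold gradient
    rwa [LinearIsometryEquiv.norm_map]
  have hplip : ∀ x y, |‖gradient u y‖ - ‖gradient u x‖| ≤ M * ‖y - x‖ := fun x y => by
    refine (abs_norm_sub_norm_le _ _).trans ?_
    rw [grad_sub_norm]; exact hM _ _
  obtain ⟨K, hK0, hK⟩ := lip_of_hcs hη1 hηc
  obtain ⟨R, hR⟩ := hcs_bound hηc
  obtain ⟨B, hB⟩ := hηcont.bounded_above_of_compact_support hηc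
  have hB0 : 0 ≤ B := (norm_nonneg _).trans (hB 0)
  set ζ : EE → ℝ := fun x => ‖gradient u x‖ * η x with hζ
  have hζlip : ∀ x z, |ζ (x + z) - ζ x| ≤ (M * K + M * B) * ‖z‖ := by
    intro x z
    have e : ζ (x + z) - ζ x = ‖gradient u (x + z)‖ * (η (x + z) - η x) +
      (‖gradient u (x + z)‖ - ‖gradient u x‖) * η x := by simp only [hζ]; ring
    rw [e]
    refine (abs_add_le _ _).trans ?_
    rw [abs_mul, abs_mul, abs_of_nonneg (norm_nonneg (gradient u (x + z)))]
    have h1 := hplip x (x + z)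
    rw [add_sub_cancel_left] at h1
    have h2 := mul_le_mul (hpM (x + z)) (hK x z) (abs_nonneg _) hMn
    have h3 := mul_le_mul h1 (hB x) (norm_nonneg _) (by positivity)
    rw [Real.norm_eq_abs] at h3
    nlinarith
  have hζc : HasCompactSupport ζ := hηc.mul_left
  have hζcont : Continuous ζ := hpcont.mul hηcont
  have hζs : ∀ x, R < ‖x‖ → ζ x = 0 := fun x hx => by simp only [hζ]; rw [hR x hx, mul_zero]
  have hζL : ∃ K, LipschitzWith K ζ := by
    refine ⟨Real.toNNReal (M * K + M * B), LipschitzWith.of_dist_le_mul fun x y => ?_⟩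
    have := hζlip y (x - y)
    rw [Real.coe_toNNReal _ (by positivity), Real.dist_eq, dist_eq_norm]
    simpa using this
  have S := hstab ζ hζL hζc
  obtain ⟨iS, eS⟩ := stab_form hJ hζcont hζlip hζs
  rw [eS] at S
  -- T integrable
  have iT : Integrable (fun q : EE × EE => J q.2 * (‖gradient u q.1‖ * ‖gradient u (q.1 + q.2)‖ *
      (η (q.1 + q.2) - η q.1) ^ 2)) := by
    refine prod_int hJ (g := fun q => ‖gradient u q.1‖ * ‖gradient u (q.1 + q.2)‖ *
      (η (q.1 + q.2) - η q.1) ^ 2) (by fun_prop) (K := M * M * K ^ 2) (R := R + d) ?_ ?_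
    · intro x z
      simp only [abs_mul, abs_pow, abs_norm]
      calc _ ≤ (M * M) * (K * ‖z‖) ^ 2 := by
            gcongr
            · exact hpM _
            · exact hpM _
            · exact hK x z
        _ = _ := by ring
    · intro x z hz hx
      have h1 : R < ‖x + z‖ := by
        have := norm_sub_norm_le x (-z)
        rw [norm_neg, sub_neg_eq_add] at this; linarith
      simp only
      rw [hR _ h1, hR x (by linarith [hJ.pos])]; simp
  have eH : (fun q : EE × EE => J q.2 * ((‖gradient u q.1‖ * ‖gradient u (q.1 + q.2)‖ -
      inner ℝ (gradient u q.1) (gradient u (q.1 + q.2))) * (η q.1 ^ 2 + η (q.1 + q.2) ^ 2))) =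
      fun q => (J q.2 * ((pd 0 u (q.1 + q.2) - pd 0 u q.1) * (pd 0 u (q.1 + q.2) * η (q.1 + q.2) ^ 2 - pd 0 u q.1 * η q.1 ^ 2))
      + J q.2 * ((pd 1 u (q.1 + q.2) - pd 1 u q.1) * (pd 1 u (q.1 + q.2) * η (q.1 + q.2) ^ 2 - pd 1 u q.1 * η q.1 ^ 2)))
      + (J q.2 * (‖gradient u q.1‖ * ‖gradient u (q.1 + q.2)‖ * (η (q.1 + q.2) - η q.1) ^ 2)
       - J q.2 * (ζ (q.1 + q.2) - ζ q.1) ^ 2) := by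
    ext q
    rw [grad_inner_eq]
    have h1 := grad_norm_sq u q.1
    have h2 := grad_norm_sq u (q.1 + q.2)
    simp only [hζ]
    linear_combination (J q.2 * η q.1 ^ 2) * h1 + (J q.2 * η (q.1 + q.2) ^ 2) * h2
  have iH := (I0.fun_add I1).fun_add (fun_sub_int iT iS)
  refine ⟨by rw [eH]; exact iH, iT, ?_⟩
  rw [eH, integral_add (I0.fun_add I1) (fun_sub_int iT iS), integral_add I0 I1, integral_sub iT iS]
  have hvv : ∀ j k, Continuous (pd j (pd k u)) := fun j k =>
    (pd_contDiff (m := 1) (n := 2) j (hv k) le_rfl).continuous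
  have hww : ∀ j k, Continuous (pd j (fun x => pd k u x * η x ^ 2)) := fun j k =>
    (pd_contDiff (m := 1) (n := 2) j (hw k) le_rfl).continuous
  have hηj : ∀ j, Continuous (pd j η) := fun j => (pd_contDiff (m := 1) (n := 2) j hη le_rfl).continuous
  have iA : ∀ k, Integrable (fun x => pd 0 (pd k u) x * pd 0 (fun x => pd k u x * η x ^ 2) x +
      pd 1 (pd k u) x * pd 1 (fun x => pd k u x * η x ^ 2) x) := fun k =>
    (((hvv 0 k).mul (hww 0 k)).integrable_of_hasCompactSupport (pd_hcs 0 (hwc k)).mul_left).fun_add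
    (((hvv 1 k).mul (hww 1 k)).integrable_of_hasCompactSupport (pd_hcs 1 (hwc k)).mul_left)
  have iG : Integrable (fun x => ‖gradient u x‖ ^ 2 * ‖gradient η x‖ ^ 2) := by
    have e : (fun x => ‖gradient u x‖ ^ 2 * ‖gradient η x‖ ^ 2) = fun x =>
       (‖gradient u x‖ ^ 2 * pd 0 η x) * pd 0 η x + (‖gradient u x‖ ^ 2 * pd 1 η x) * pd 1 η x := by
      ext x; rw [grad_norm_sq η]; ring
    rw [e]
    exact ((((hpcont.pow 2).mul (hηj 0)).mul (hηj 0)).integrable_of_hasCompactSupport (pd_hcs 0 hηc).mul_left).fun_add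
      ((((hpcont.pow 2).mul (hηj 1)).mul (hηj 1)).integrable_of_hasCompactSupport (pd_hcs 1 hηc).mul_left)
  have hA : ∫ x, ‖gradient ζ x‖ ^ 2 ≤ _ :=
    integral_mono_of_nonneg (Eventually.of_forall fun x => by positivity)
      (((iA 0).fun_add (iA 1)).fun_add iG) (Eventually.of_forall fun x => kato hu hη hη0 x)
  rw [integral_add ((iA 0).fun_add (iA 1)) iG, integral_add (iA 0) (iA 1)] at hA
  have hfd : Continuous (deriv f) := hf.continuous_deriv (by norm_num)
  have huc := hu.continuous
  have iF : ∀ k, Integrable (fun x => deriv f (u x) * (pd k u x * (pd k u x * η x ^ 2))) := fun k =>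
    Continuous.integrable_of_hasCompactSupport (by have := hvcont k; fun_prop) ((hwc k).mul_left.mul_left)
  have eF : ∫ x, deriv f (u x) * ζ x ^ 2 = (∫ x, deriv f (u x) * (pd 0 u x * (pd 0 u x * η x ^ 2))) +
      ∫ x, deriv f (u x) * (pd 1 u x * (pd 1 u x * η x ^ 2)) := by
    rw [← integral_add (iF 0) (iF 1)]
    congr 1; ext x
    have h1 := grad_norm_sq u x
    simp only [hζ]
    linear_combination (deriv f (u x) * η x ^ 2) * h1
  rw [eF, W0, W1] at S
  linarith


lemma st_deriv_bdd : ∃ C, 0 ≤ C ∧ ∀ t, |deriv Real.smoothTransition t| ≤ C := by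
  have hc : Continuous (deriv Real.smoothTransition) :=
    (Real.smoothTransition.contDiff (n := 1)).continuous_deriv (by norm_num)
  have hs : HasCompactSupport (deriv Real.smoothTransition) := by
    refine HasCompactSupport.intro (isCompact_Icc (a := (0:ℝ)) (b := 1)) fun t ht => ?_
    rw [mem_Icc, not_and_or, not_le, not_le] at ht
    rcases ht with ht | ht
    · have : Real.smoothTransition =ᶠ[𝓝 t] fun _ => 0 := by
        filter_upwards [Iio_mem_nhds ht] with s hs
        exact Real.smoothTransition.zero_of_nonpos (le_of_lt hs)
      rw [this.deriv_eq]; simp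
    · have : Real.smoothTransition =ᶠ[𝓝 t] fun _ => 1 := by
        filter_upwards [Ioi_mem_nhds ht] with s hs
        exact Real.smoothTransition.one_of_one_le (le_of_lt hs)
      rw [this.deriv_eq]; simp
  obtain ⟨C, hC⟩ := hc.bounded_above_of_compact_support hs
  exact ⟨C, (norm_nonneg _).trans (hC 0), hC⟩

/-- logarithmic cutoff -/
def eta (R : ℝ) (x : EE) : ℝ := Real.smoothTransition (2 - Real.log (1 + ‖x‖ ^ 2) / R)

lemma eta_contDiff (R : ℝ) : ContDiff ℝ 2 (eta R) := by
  unfold eta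
  refine Real.smoothTransition.contDiff.comp (contDiff_const.sub (ContDiff.div_const ?_ R))
  refine ContDiff.log (contDiff_const.add (contDiff_norm_sq ℝ)) fun x => by positivity

lemma eta_zero {R : ℝ} (hR : 0 < R) {x : EE} (hx : Real.exp R ≤ ‖x‖) : eta R x = 0 := by
  apply Real.smoothTransition.zero_of_nonpos
  rw [sub_nonpos, le_div_iff₀ hR, Real.le_log_iff_exp_le (by positivity)]
  have : Real.exp (2 * R) = Real.exp R ^ 2 := by rw [← Real.exp_nat_mul]; norm_num
  rw [this]
  have h := pow_le_pow_left₀ (Real.exp_pos R).le hx 2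
  linarith

lemma eta_one {R : ℝ} (hR : 0 < R) {x : EE} (hx : ‖x‖ ^ 2 ≤ R) : eta R x = 1 := by
  apply Real.smoothTransition.one_of_one_le
  have : Real.log (1 + ‖x‖ ^ 2) ≤ ‖x‖ ^ 2 := by
    have := Real.log_le_sub_one_of_pos (show 0 < 1 + ‖x‖ ^ 2 by positivity)
    linarith
  have h2 : Real.log (1 + ‖x‖ ^ 2) / R ≤ 1 := by rw [div_le_one hR]; linarith
  linarith

lemma eta_fderiv {C : ℝ} (hC : ∀ t, |deriv Real.smoothTransition t| ≤ C) {R : ℝ} (hR : 0 < R) (y : EE) :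
    ‖fderiv ℝ (eta R) y‖ ^ 2 ≤ 4 * C ^ 2 / R ^ 2 / (1 + ‖y‖ ^ 2) := by
  have hC0 : 0 ≤ C := (abs_nonneg _).trans (hC 0)
  have h1 : HasFDerivAt (fun x : EE => ‖x‖ ^ 2) (2 • innerSL ℝ y) y := (hasStrictFDerivAt_norm_sq y).hasFDerivAt
  have hp : 0 < 1 + ‖y‖ ^ 2 := by positivity
  have h2 : HasDerivAt (fun s : ℝ => 2 - Real.log (1 + s) / R) (-(1 / (1 + ‖y‖ ^ 2) / R)) (‖y‖ ^ 2) := by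
    have a := ((hasDerivAt_id (‖y‖ ^ 2)).const_add 1).log (by simpa using hp.ne')
    simpa using (a.div_const R).const_sub 2
  have h3 := ((Real.smoothTransition.contDiff (n := 1)).differentiable (by norm_num)
    (2 - Real.log (1 + ‖y‖ ^ 2) / R)).hasDerivAt
  have h4 := (h3.comp (‖y‖ ^ 2) h2).comp_hasFDerivAt y h1
  have h5 : fderiv ℝ (eta R) y = _ := h4.fderiv
  set D := deriv Real.smoothTransition (2 - Real.log (1 + ‖y‖ ^ 2) / R) with hD
  have hn : ‖fderiv ℝ (eta R) y‖ ≤ C * (1 / (1 + ‖y‖ ^ 2) / R) * (2 * ‖y‖) := by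
    rw [h5, norm_smul, norm_mul, norm_neg, Real.norm_eq_abs, Real.norm_eq_abs]
    rw [abs_of_nonneg (show 0 ≤ 1 / (1 + ‖y‖ ^ 2) / R by positivity)]
    have : ‖(2 • innerSL ℝ y : EE →L[ℝ] ℝ)‖ ≤ 2 * ‖y‖ := by
      refine (norm_nsmul_le).trans ?_
      rw [innerSL_apply_norm]; simp
    gcongr
    exact hC _
  calc ‖fderiv ℝ (eta R) y‖ ^ 2 ≤ (C * (1 / (1 + ‖y‖ ^ 2) / R) * (2 * ‖y‖)) ^ 2 := by gcongr
    _ = 4 * C ^ 2 / R ^ 2 / (1 + ‖y‖ ^ 2) * (‖y‖ ^ 2 / (1 + ‖y‖ ^ 2)) := by field_simp; ring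
    _ ≤ 4 * C ^ 2 / R ^ 2 / (1 + ‖y‖ ^ 2) * 1 := by
      gcongr
      rw [div_le_one hp]; linarith
    _ = _ := by ring

lemma radial_int {Y : ℝ} (hY : 0 ≤ Y) :
    Integrable (fun x : EE => (Iic Y).indicator (fun s : ℝ => 1 / (1 + s ^ 2)) ‖x‖) ∧
    ∫ x : EE, (Iic Y).indicator (fun s : ℝ => 1 / (1 + s ^ 2)) ‖x‖ ≤
      2 * (volume.real (ball (0:EE) 1)) * Real.log (1 + Y) := by
  have hcont : Continuous (fun s : ℝ => s * (1 / (1 + s ^ 2))) := by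
    refine continuous_id.mul (continuous_const.div (by fun_prop) fun s => by positivity)
  have e : (fun y : ℝ => y ^ (Module.finrank ℝ EE - 1) • (Iic Y).indicator (fun s : ℝ => 1 / (1 + s ^ 2)) y)
      = (Iic Y).indicator (fun s : ℝ => s * (1 / (1 + s ^ 2))) := by
    ext y
    by_cases hy : y ∈ Iic Y
    · simp [indicator_of_mem hy]
    · simp [indicator_of_notMem hy]
  constructor
  · rw [integrable_fun_norm_addHaar (volume : Measure EE) (f := (Iic Y).indicator (fun s : ℝ => 1 / (1 + s ^ 2))), e]
    rw [IntegrableOn, integrable_indicator_iff measurableSet_Iic, IntegrableOn, Measure.restrict_restrict measurableSet_Iic,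
      inter_comm, Ioi_inter_Iic]
    exact (hcont.integrableOn_Icc (a := 0) (b := Y)).mono_set Ioc_subset_Icc_self
  · rw [integral_fun_norm_addHaar (volume : Measure EE) (f := (Iic Y).indicator (fun s : ℝ => 1 / (1 + s ^ 2))), e]
    rw [integral_indicator measurableSet_Iic, Measure.restrict_restrict measurableSet_Iic,
      inter_comm, Ioi_inter_Iic, ← intervalIntegral.integral_of_le hY]
    have hF : ∫ s in (0:ℝ)..Y, s * (1 / (1 + s ^ 2)) = Real.log (1 + Y ^ 2) / 2 - Real.log (1 + 0 ^ 2) / 2 := by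
      refine intervalIntegral.integral_eq_sub_of_hasDerivAt (f := fun s : ℝ => Real.log (1 + s ^ 2) / 2) (fun s _ => ?_)
        (hcont.intervalIntegrable _ _)
      have hp : (1 + s ^ 2 : ℝ) ≠ 0 := by positivity
      have a := (((hasDerivAt_pow 2 s).const_add 1).log hp).div_const 2
      refine a.congr_deriv ?_
      have hh : ∀ t : ℝ, (((2:ℕ):ℝ) * s ^ (2-1)) / t / 2 = s * (1 / t) := by
        intro t; push_cast; ring
      exact hh _
    rw [hF]
    have hl : Real.log (1 + Y ^ 2) / 2 - Real.log (1 + 0 ^ 2) / 2 ≤ Real.log (1 + Y) := by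
      have : Real.log (1 + Y ^ 2) ≤ Real.log ((1 + Y) ^ 2) := by
        apply Real.log_le_log (by positivity); nlinarith
      rw [Real.log_pow] at this
      simp at this ⊢; linarith
    simp only [finrank_euclideanSpace, Fintype.card_fin, nsmul_eq_mul, smul_eq_mul, Nat.cast_ofNat]
    have hv : 0 ≤ volume.real (ball (0:EE) 1) := measureReal_nonneg
    rw [mul_assoc]
    gcongr

lemma cutoff {d : ℝ} (hd : 0 < d) (r : ℝ) {ε : ℝ} (hε : 0 < ε) :
    ∃ η : EE → ℝ, ContDiff ℝ 2 η ∧ HasCompactSupport η ∧ (∀ x, 0 ≤ η x) ∧ (∀ x, ‖x‖ ≤ r → η x = 1) ∧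
    ∃ G : EE → ℝ, Integrable G ∧ (∀ x, 0 ≤ G x) ∧ ∫ x, G x ≤ ε ∧ (∀ x, ‖gradient η x‖ ^ 2 ≤ G x) ∧
      ∀ x z, ‖z‖ ≤ d → (η (x + z) - η x) ^ 2 ≤ ‖z‖ ^ 2 * G x := by
  obtain ⟨C, hC0, hC⟩ := st_deriv_bdd
  set A : ℝ := 2 + 2 * d ^ 2 with hA
  set V : ℝ := volume.real (ball (0:EE) 1) with hV
  have hV0 : 0 ≤ V := measureReal_nonneg
  obtain ⟨R, hR⟩ := exists_gt (max (max 1 (r ^ 2)) (max (1 + d) (16 * C ^ 2 * A * V / ε)))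
  simp only [max_lt_iff] at hR
  obtain ⟨⟨hR1, hRr⟩, hRd, hRε⟩ := hR
  have hR0 : 0 < R := by linarith
  set Y : ℝ := Real.exp R + d with hY
  have hY0 : 0 ≤ Y := by positivity
  obtain ⟨iG, eG⟩ := radial_int hY0
  set G : EE → ℝ := fun x => (4 * C ^ 2 * A / R ^ 2) * (Iic Y).indicator (fun s : ℝ => 1 / (1 + s ^ 2)) ‖x‖ with hG
  have hA0 : 0 < A := by positivity
  have hGn : ∀ x, 0 ≤ G x := fun x => by
    simp only [hG]
    refine mul_nonneg (by positivity) (indicator_nonneg (fun s _ => by positivity) _)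
  have hfd : ∀ x y : EE, ‖y - x‖ ≤ d → ‖fderiv ℝ (eta R) y‖ ≤ √(G x) := by
    intro x y hxy
    apply Real.le_sqrt_of_sq_le
    by_cases hx : ‖x‖ ≤ Y
    · simp only [hG]
      rw [indicator_of_mem (by exact hx)]
      refine (eta_fderiv hC hR0 y).trans ?_
      have h1 : 1 + ‖x‖ ^ 2 ≤ A * (1 + ‖y‖ ^ 2) := by
        have : ‖x‖ ≤ ‖y‖ + d := by
          have := norm_sub_norm_le x y
          rw [norm_sub_rev] at this; linarith
        have h2 : ‖x‖ ^ 2 ≤ (‖y‖ + d) ^ 2 := by gcongr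
        rw [hA]
        nlinarith [sq_nonneg (‖y‖ - d), sq_nonneg ‖y‖, sq_nonneg (d * ‖y‖)]
      have h2 : 1 / (1 + ‖y‖ ^ 2) ≤ A * (1 / (1 + ‖x‖ ^ 2)) := by
        rw [mul_one_div, div_le_div_iff₀ (by positivity) (by positivity)]; linarith
      calc 4 * C ^ 2 / R ^ 2 / (1 + ‖y‖ ^ 2) = 4 * C ^ 2 / R ^ 2 * (1 / (1 + ‖y‖ ^ 2)) := by ring
        _ ≤ 4 * C ^ 2 / R ^ 2 * (A * (1 / (1 + ‖x‖ ^ 2))) := by gcongr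
        _ = _ := by ring
    · have hy : Real.exp R < ‖y‖ := by
        have := norm_sub_norm_le x y
        rw [norm_sub_rev] at this; push Not at hx; linarith
      have h0 : eta R =ᶠ[𝓝 y] fun _ => 0 := by
        filter_upwards [(isOpen_lt continuous_const continuous_norm).mem_nhds hy] with s hs
        exact eta_zero hR0 (le_of_lt hs)
      rw [h0.fderiv_eq]
      simpa using hGn x
  have hdiff : Differentiable ℝ (eta R) := (eta_contDiff R).differentiable (by norm_num)
  refine ⟨eta R, eta_contDiff R, ?_, fun x => Real.smoothTransition.nonneg _, fun x hx => ?_, G,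
    iG.const_mul _, hGn, ?_, fun x => ?_, fun x z hz => ?_⟩
  · refine HasCompactSupport.intro (isCompact_closedBall (0:EE) (Real.exp R)) fun x hx => ?_
    rw [mem_closedBall_zero_iff, not_le] at hx
    exact eta_zero hR0 hx.le
  · apply eta_one hR0
    have : ‖x‖ ^ 2 ≤ r ^ 2 := by gcongr
    linarith
  · simp only [hG]
    rw [integral_const_mul]
    have hlog : Real.log (1 + Y) ≤ 2 * R := by
      have h1 : 1 + Y ≤ Real.exp R * (2 + d) := by
        have := Real.one_le_exp hR0.le
        rw [hY]; nlinarith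
      have h2 : Real.log (1 + Y) ≤ Real.log (Real.exp R * (2 + d)) := Real.log_le_log (by positivity) h1
      rw [Real.log_mul (Real.exp_pos R).ne' (by positivity), Real.log_exp] at h2
      have := Real.log_le_sub_one_of_pos (show 0 < 2 + d by positivity)
      linarith
    calc _ ≤ 4 * C ^ 2 * A / R ^ 2 * (2 * V * Real.log (1 + Y)) := by gcongr
      _ ≤ 4 * C ^ 2 * A / R ^ 2 * (2 * V * (2 * R)) := by gcongr
      _ = 16 * C ^ 2 * A * V / R := by field_simp; ring
      _ ≤ ε := by
        rw [div_lt_iff₀ hε] at hRε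
        rw [div_le_iff₀ hR0]; linarith
  · have h1 := hfd x x (by simpa using hd.le)
    have h2 : ‖gradient (eta R) x‖ = ‖fderiv ℝ (eta R) x‖ := by
      unfold gradient; rw [LinearIsometryEquiv.norm_map]
    rw [h2]
    calc _ ≤ √(G x) ^ 2 := by gcongr
      _ = _ := Real.sq_sqrt (hGn x)
  · have := (convex_closedBall x d).norm_image_sub_le_of_norm_fderiv_le (𝕜 := ℝ) (fun y _ => hdiff y)
      (fun y hy => hfd x y (by simpa [dist_eq_norm] using hy)) (mem_closedBall_self hd.le)
      (show x + z ∈ closedBall x d by simpa [dist_eq_norm] using hz)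
    rw [add_sub_cancel_left] at this
    calc _ = ‖eta R (x + z) - eta R x‖ ^ 2 := by rw [Real.norm_eq_abs, sq_abs]
      _ ≤ (√(G x) * ‖z‖) ^ 2 := by gcongr
      _ = _ := by rw [mul_pow, Real.sq_sqrt (hGn x)]; ring


lemma grad_norm_le {u : EE → ℝ} {M : ℝ} (hM : ∀ x, ‖fderiv ℝ u x‖ ≤ M) (x : EE) : ‖gradient u x‖ ≤ M := by
  unfold gradient
  rw [LinearIsometryEquiv.norm_map]
  exact hM x

lemma rhs_bound {J : EE → ℝ} {d : ℝ} (hJ : Ker J d) {u η G : EE → ℝ} {M ε : ℝ} (hM0 : 0 ≤ M)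
    (hM : ∀ x, ‖fderiv ℝ u x‖ ≤ M) (iG : Integrable G) (hG0 : ∀ x, 0 ≤ G x) (hGε : ∫ x, G x ≤ ε)
    (hG1 : ∀ x, ‖gradient η x‖ ^ 2 ≤ G x)
    (hG2 : ∀ x z, ‖z‖ ≤ d → (η (x + z) - η x) ^ 2 ≤ ‖z‖ ^ 2 * G x) :
    (∫ x, ‖gradient u x‖ ^ 2 * ‖gradient η x‖ ^ 2) ≤ M ^ 2 * ε ∧
    (∫ q : EE × EE, J q.2 * (‖gradient u q.1‖ * ‖gradient u (q.1 + q.2)‖ * (η (q.1 + q.2) - η q.1) ^ 2))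
      ≤ M ^ 2 * (ε * ∫ z, ‖z‖ ^ 2 * J z) := by
  have hg := grad_norm_le hM
  have hI : 0 ≤ ∫ z, ‖z‖ ^ 2 * J z := integral_nonneg fun z => hJ.sq_nonneg z
  constructor
  · calc (∫ x, ‖gradient u x‖ ^ 2 * ‖gradient η x‖ ^ 2) ≤ ∫ x, M ^ 2 * G x := by
          refine integral_mono_of_nonneg (Eventually.of_forall fun x => by positivity) (iG.const_mul _)
            (Eventually.of_forall fun x => ?_)
          have := hg x
          have := hG1 x
          dsimp only
          gcongr
      _ = M ^ 2 * ∫ x, G x := integral_const_mul _ _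
      _ ≤ _ := by gcongr
  · calc _ ≤ ∫ q : EE × EE, M ^ 2 * (G q.1 * (‖q.2‖ ^ 2 * J q.2)) := by
          refine integral_mono_of_nonneg (Eventually.of_forall fun q => ?_)
            ((iG.mul_prod hJ.int).const_mul _) (Eventually.of_forall fun q => ?_)
          · by_cases hz : q.2 = 0
            · simp [hz]
            · exact mul_nonneg (hJ.nonneg _ hz) (by positivity)
          · dsimp only
            by_cases hz : q.2 = 0
            · simp [hz]
            have hJ0 := hJ.nonneg _ hz
            rcases le_or_gt ‖q.2‖ d with hd | hd
            · have h1 := hG2 q.1 q.2 hd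
              have h2 : ‖gradient u q.1‖ * ‖gradient u (q.1 + q.2)‖ ≤ M * M :=
                mul_le_mul (hg _) (hg _) (norm_nonneg _) hM0
              calc J q.2 * (‖gradient u q.1‖ * ‖gradient u (q.1 + q.2)‖ * (η (q.1 + q.2) - η q.1) ^ 2)
                  ≤ J q.2 * (M * M * (‖q.2‖ ^ 2 * G q.1)) := by gcongr
                _ = _ := by ring
            · rw [hJ.far _ hd]; simp
      _ = M ^ 2 * ((∫ x, G x) * ∫ z, ‖z‖ ^ 2 * J z) := by
          rw [integral_const_mul, Measure.volume_eq_prod,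
            integral_prod_mul G (fun z => ‖z‖ ^ 2 * J z)]
      _ ≤ _ := by gcongr

lemma parallel {J : EE → ℝ} (hJmeas : Measurable J)
    (hJnonneg : ∀ z, z ≠ 0 → 0 ≤ J z) (hJeven : ∀ z, z ≠ 0 → J (-z) = J z)
    {δ₀ δ₁ lam Lam α β : ℝ} (hδ₁ : 0 < δ₁) (hδ : δ₁ ≤ δ₀)
    (hlam : 0 < lam) (hα2 : α < 2) (hβ : 0 < β)
    (hJlow : ∀ z, z ≠ 0 → lam * ‖z‖ ^ (-(2:ℝ) - β) * (if ‖z‖ ≤ δ₁ then 1 else 0) ≤ J z)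
    (hJup : ∀ z, z ≠ 0 → J z ≤ Lam * ‖z‖ ^ (-(2:ℝ) - α) * (if ‖z‖ ≤ δ₀ then 1 else 0))
    {c : ℝ} (hc : 0 < c) {f : ℝ → ℝ} (hf : ContDiff ℝ 1 f)
    {u : EE → ℝ} (hu : ContDiff ℝ 3 u) (hub : BddDerivs 3 u)
    {Lu : EE → ℝ} (hLu : ∀ x, HasPV J u x (Lu x))
    (heq : ∀ x, lap u x + c * Lu x + f (u x) = 0)
    (hstab : IsStable J c f u) (x0 y0 : EE) (hxy : ‖y0 - x0‖ < δ₁) :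
    ‖gradient u x0‖ * ‖gradient u y0‖ = inner ℝ (gradient u x0) (gradient u y0) := by
  have hδ₀ : 0 < δ₀ := hδ₁.trans_le hδ
  have hJ : Ker J δ₀ := ker_mk J hJmeas hJnonneg hJeven δ₀ Lam α hδ₀ hα2 hJup
  obtain ⟨M, hM0, hM1, hM, hM2⟩ := bdd_fderiv hu hub
  by_contra hne
  set h : EE × EE → ℝ := fun q => ‖gradient u q.1‖ * ‖gradient u (q.1 + q.2)‖ -
    inner ℝ (gradient u q.1) (gradient u (q.1 + q.2)) with hh
  have hgc := grad_cont hu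
  have hcont : Continuous h := by
    have h1 : Continuous fun q : EE × EE => gradient u q.1 := hgc.comp continuous_fst
    have h2 : Continuous fun q : EE × EE => gradient u (q.1 + q.2) :=
      hgc.comp (continuous_fst.add continuous_snd)
    exact (h1.norm.mul h2.norm).sub (h1.inner h2)
  have hnn : ∀ q, 0 ≤ h q := fun q => sub_nonneg.2 (real_inner_le_norm _ _)
  have hz0 : ∀ x, h (x, 0) = 0 := by
    intro x; simp only [hh, add_zero, real_inner_self_eq_norm_mul_norm, sub_self]
  set z0 := y0 - x0 with hz0d
  have hpos : 0 < h (x0, z0) := by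
    refine lt_of_le_of_ne (hnn _) fun h0 => hne ?_
    have : x0 + z0 = y0 := by simp [hz0d]
    simp only [hh, this] at h0
    linarith
  set h0 := h (x0, z0) / 2 with hh0
  have h0pos : 0 < h0 := by positivity
  have hev : ∀ᶠ q in 𝓝 (x0, z0), h0 < h q ∧ ‖q.2‖ < δ₁ := by
    refine (hcont.continuousAt.eventually (lt_mem_nhds (by rw [hh0]; linarith))).and ?_
    exact (continuous_snd.norm.continuousAt (x := (x0, z0))).eventually (gt_mem_nhds hxy)
  obtain ⟨ρ, hρ, hball⟩ := Metric.eventually_nhds_iff_ball.1 hev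
  set S : Set (EE × EE) := ball x0 ρ ×ˢ ball z0 ρ with hS
  have hSm : MeasurableSet S := measurableSet_ball.prod measurableSet_ball
  have hSb : ∀ q ∈ S, h0 < h q ∧ ‖q.2‖ < δ₁ := fun q hq => by
    refine hball q ?_
    rw [← ball_prod_same]; exact hq
  have hSvol : volume S = volume (ball x0 ρ) * volume (ball z0 ρ) := by
    rw [Measure.volume_eq_prod, hS, Measure.prod_prod]
  have hSfin : volume S ≠ ⊤ := by
    rw [hSvol]; exact ENNReal.mul_ne_top measure_ball_lt_top.ne measure_ball_lt_top.ne
  have hSpos : 0 < volume.real S := by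
    refine ENNReal.toReal_pos ?_ hSfin
    rw [hSvol]
    exact mul_ne_zero (measure_ball_pos _ _ hρ).ne' (measure_ball_pos _ _ hρ).ne'
  set j0 := lam * δ₁ ^ (-(2:ℝ) - β) with hj0
  have j0pos : 0 < j0 := by positivity
  have hSJ : ∀ q ∈ S, j0 ≤ J q.2 := by
    intro q hq
    obtain ⟨h1, h2⟩ := hSb q hq
    have hne0 : q.2 ≠ 0 := by
      intro h3
      have : h q = 0 := by rw [← hz0 q.1, ← h3]
      linarith
    have := hJlow q.2 hne0
    rw [if_pos h2.le, mul_one] at this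
    refine le_trans ?_ this
    rw [hj0]
    refine mul_le_mul_of_nonneg_left ?_ hlam.le
    exact Real.rpow_le_rpow_of_nonpos (norm_pos_iff.2 hne0) h2.le (by linarith)
  set I := ∫ z, ‖z‖ ^ 2 * J z with hI
  have hI0 : 0 ≤ I := integral_nonneg fun z => hJ.sq_nonneg z
  set κ := j0 * h0 * volume.real S with hκ
  have κpos : 0 < κ := by positivity
  have key : ∀ ε > 0, c / 2 * κ ≤ M ^ 2 * (1 + c / 2 * I) * ε := by
    intro ε hε
    obtain ⟨η, hη, hηc, hη0, hη1, G, iG, hG0, hGε, hG1, hG2⟩ := cutoff hδ₀ (‖x0‖ + ρ) hε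
    obtain ⟨iH, -, hP⟩ := poincare hJ hc hf hu hM1 hM hM2 hLu heq hstab hη hηc hη0
    obtain ⟨hR1, hR2⟩ := rhs_bound hJ (u := u) hM0 hM iG hG0 hGε hG1 hG2
    have hHn : ∀ q : EE × EE, 0 ≤ J q.2 * ((‖gradient u q.1‖ * ‖gradient u (q.1 + q.2)‖ -
        inner ℝ (gradient u q.1) (gradient u (q.1 + q.2))) * (η q.1 ^ 2 + η (q.1 + q.2) ^ 2)) := by
      intro q
      by_cases hz : q.2 = 0
      · have : h q = 0 := by rw [← hz0 q.1, ← hz]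
        simp only [hh] at this
        rw [this]; simp
      · exact mul_nonneg (hJ.nonneg _ hz) (mul_nonneg (hnn q) (by positivity))
    have hL : κ ≤ ∫ q : EE × EE, J q.2 * ((‖gradient u q.1‖ * ‖gradient u (q.1 + q.2)‖ -
        inner ℝ (gradient u q.1) (gradient u (q.1 + q.2))) * (η q.1 ^ 2 + η (q.1 + q.2) ^ 2)) := by
      calc κ = ∫ q in S, j0 * h0 := by rw [setIntegral_const, smul_eq_mul, hκ]; ring
        _ ≤ ∫ q in S, J q.2 * ((‖gradient u q.1‖ * ‖gradient u (q.1 + q.2)‖ -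
          inner ℝ (gradient u q.1) (gradient u (q.1 + q.2))) * (η q.1 ^ 2 + η (q.1 + q.2) ^ 2)) := by
            refine setIntegral_mono_on (integrableOn_const hSfin) iH.integrableOn hSm fun q hq => ?_
            have h1 := hSJ q hq
            have h2 := (hSb q hq).1
            have h3 : η q.1 = 1 := by
              apply hη1
              have : ‖q.1 - x0‖ < ρ := mem_ball_iff_norm.1 hq.1
              have := norm_le_norm_add_norm_sub x0 q.1
              rw [norm_sub_rev] at this
              linarith
            have h4 : h0 ≤ (‖gradient u q.1‖ * ‖gradient u (q.1 + q.2)‖ -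
                inner ℝ (gradient u q.1) (gradient u (q.1 + q.2))) * (η q.1 ^ 2 + η (q.1 + q.2) ^ 2) := by
              rw [h3]
              refine h2.le.trans ?_
              refine le_mul_of_one_le_right (hnn q) ?_
              nlinarith [sq_nonneg (η (q.1 + q.2))]
            exact mul_le_mul h1 h4 h0pos.le (j0pos.le.trans h1)
        _ ≤ _ := setIntegral_le_integral iH (Eventually.of_forall hHn)
    have hc2 : 0 ≤ c / 2 := by positivity
    have a1 := mul_le_mul_of_nonneg_left hL hc2
    have a2 := mul_le_mul_of_nonneg_left hR2 hc2
    calc c / 2 * κ ≤ _ := a1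
      _ ≤ _ := hP
      _ ≤ M ^ 2 * ε + c / 2 * (M ^ 2 * (ε * I)) := add_le_add hR1 a2
      _ = _ := by ring
  set B := M ^ 2 * (1 + c / 2 * I) with hB
  have hB0 : 0 ≤ B := by positivity
  have hkk : 0 < c / 2 * κ := by positivity
  have := key ((c / 2 * κ) / (2 * (B + 1))) (by positivity)
  have h2 : B * ((c / 2 * κ) / (2 * (B + 1))) < c / 2 * κ := by
    rw [mul_div_assoc', div_lt_iff₀ (by positivity)]
    nlinarith
  linarith


/-- De Giorgi type result for truncated kernels in two dimensions:
a bounded stable solution of `Δu + c L[u] + f(u) = 0` in `ℝ²` with a truncated jump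
kernel is one-dimensional. -/
theorem stmt_0
    (J : EuclideanSpace ℝ (Fin 2) → ℝ) (hJmeas : Measurable J)
    (hJnonneg : ∀ z, z ≠ 0 → 0 ≤ J z) (hJeven : ∀ z, z ≠ 0 → J (-z) = J z)
    (δ₀ δ₁ lam Lam α β : ℝ) (hδ₁ : 0 < δ₁) (hδ : δ₁ ≤ δ₀)
    (hlam : 0 < lam) (hLam : lam ≤ Lam)
    (hα : 0 < α) (hα2 : α < 2) (hβ : 0 < β) (hβ2 : β < 2)
    (hJlow : ∀ z, z ≠ 0 → lam * ‖z‖ ^ (-(2:ℝ) - β) * (if ‖z‖ ≤ δ₁ then 1 else 0) ≤ J z)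
    (hJup : ∀ z, z ≠ 0 → J z ≤ Lam * ‖z‖ ^ (-(2:ℝ) - α) * (if ‖z‖ ≤ δ₀ then 1 else 0))
    (c : ℝ) (hc : 0 < c) (f : ℝ → ℝ) (hf : ContDiff ℝ 1 f)
    (u : EuclideanSpace ℝ (Fin 2) → ℝ) (hu : ContDiff ℝ 3 u) (hub : BddDerivs 3 u)
    (Lu : EuclideanSpace ℝ (Fin 2) → ℝ) (hLu : ∀ x, HasPV J u x (Lu x))
    (heq : ∀ x, lap u x + c * Lu x + f (u x) = 0)
    (hstab : IsStable J c f u) :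
    ∃ e : EuclideanSpace ℝ (Fin 2), ‖e‖ = 1 ∧ ∃ g : ℝ → ℝ,
      ∀ x, u x = g (@inner ℝ _ _ e x) := by
  exact geo_final hu hδ₁ fun x y hxy =>
    parallel hJmeas hJnonneg hJeven hδ₁ hδ hlam hα2 hβ hJlow hJup hc hf hu hub hLu heq hstab x y hxy
end
end

section
/- (Monotonicity formula for radial extension solutions.) Fix n ≥ 1, 0 < α < 2, a := 1 − α, constants c > 0 and d_α > 0, f ∈ C¹(ℝ), and F ∈ C¹(ℝ) with F′ = −f. Let v : (0,∞)×[0,∞) → ℝ, (r,y) ↦ v(r,y), be bounded and smooth, satisfying ∂_{rr}v + ((n−1)/r)∂_r v + ∂_{yy}v + (a/y)∂_y v = 0 for all r, y > 0, and the boundary condition −lim_{y→0⁺} y^a ∂_y v(r,y) = (d_α/c)( ∂²_r v(r,0) + ((n−1)/r)∂_r v(r,0) + f(v(r,0)) ) for every r > 0. Assume for every r > 0: ∫₀^∞ y^a (|∂_r v|² + |∂_y v|²)(r,y) dy < ∞; lim_{y→∞} y^a (∂_r v · ∂_y v)(r,y) = 0; and d/dr ∫₀^∞ y^a [(∂_r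 v)² − (∂_y v)²](r,y) dy = 2∫₀^∞ y^a [∂_r v · ∂_{rr} v − ∂_y v · ∂_{ry} v](r,y) dy. Then the function I(r) := d_α (∂_r v(r,0))² + c ∫₀^∞ y^a [(∂_r v)² − (∂_y v)²](r,y) dy − 2 d_α F(v(r,0)) is nonincreasing on (0,∞). -/
open MeasureTheory Filter Set
open scoped Topology

noncomputable section

/-- `∂ₓv(x,y)`. -/
def dX (v : ℝ → ℝ → ℝ) (x y : ℝ) : ℝ := deriv (fun s => v s y) x

/-- `∂_y v(x,y)`. -/
def dY (v : ℝ → ℝ → ℝ) (x y : ℝ) : ℝ := deriv (fun t => v x t) y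

/-- `∂ₓₓv(x,y)`. -/
def dXX (v : ℝ → ℝ → ℝ) (x y : ℝ) : ℝ := deriv (fun s => dX v s y) x

/-- `∂ₓ∂_y v(x,y)`. -/
def dXY (v : ℝ → ℝ → ℝ) (x y : ℝ) : ℝ := deriv (fun s => dY v s y) x

/-- `w(x) = (1/2)∫₀^∞ yᵃ [(∂ₓv)² - (∂_yv)²](x,y) dy`. -/
def wfun (v : ℝ → ℝ → ℝ) (a : ℝ) (x : ℝ) : ℝ :=
  (1 / 2) * ∫ y in Ioi (0:ℝ), y ^ a * ((dX v x y) ^ 2 - (dY v x y) ^ 2)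


/-- truncated integrals converge -/
lemma aux_tendsto_trunc {k : ℝ → ℝ} (hk : IntegrableOn k (Ioi 0)) :
    Tendsto (fun m : ℕ => ∫ y in (1 / ((m:ℝ) + 1))..((m:ℝ) + 1), k y) atTop
      (𝓝 (∫ y in Ioi (0:ℝ), k y)) := by
  have h1 : Tendsto (fun m : ℕ => 1 / ((m:ℝ) + 1)) atTop (𝓝 0) :=
    tendsto_one_div_add_atTop_nhds_zero_nat
  have h2 : Tendsto (fun m : ℕ => (m:ℝ) + 1) atTop atTop :=
    tendsto_atTop_add_const_right _ _ tendsto_natCast_atTop_atTop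
  have hcov : AECover (volume.restrict (Ioi (0:ℝ))) atTop
      (fun m : ℕ => Ioi (1 / ((m:ℝ) + 1)) ∩ Iic ((m:ℝ) + 1)) :=
    (aecover_Ioi_of_Ioi h1).inter (aecover_Iic h2)
  refine (hcov.integral_tendsto_of_countably_generated hk).congr fun m => ?_
  have hm : (0:ℝ) < (m:ℝ) + 1 := by positivity
  have hle : 1 / ((m:ℝ) + 1) ≤ (m:ℝ) + 1 := by
    rw [div_le_iff₀ hm]; nlinarith [(Nat.cast_nonneg m : (0:ℝ) ≤ m)]
  rw [intervalIntegral.integral_of_le hle, Measure.restrict_restrict (by measurability)]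
  congr 2
  ext y
  simp only [mem_inter_iff, mem_Ioi, mem_Iic, mem_Ioc]
  constructor
  · rintro ⟨h, _⟩; exact h
  · intro h; exact ⟨h, lt_trans (by positivity) h.1⟩

lemma aux_eps (m : ℕ) : 0 < 1 / ((m:ℝ) + 1) ∧ 0 < (m:ℝ) + 1 ∧ 1 / ((m:ℝ) + 1) ≤ (m:ℝ) + 1 := by
  have hm : (0:ℝ) < (m:ℝ) + 1 := by positivity
  refine ⟨by positivity, hm, ?_⟩
  rw [div_le_iff₀ hm]; nlinarith [(Nat.cast_nonneg m : (0:ℝ) ≤ m)]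

lemma aux_eps_tendsto : Tendsto (fun m : ℕ => 1 / ((m:ℝ) + 1)) atTop (𝓝[>] 0) := by
  refine tendsto_nhdsWithin_iff.2 ⟨tendsto_one_div_add_atTop_nhds_zero_nat, ?_⟩
  exact Eventually.of_forall fun m => (aux_eps m).1

lemma aux_R_tendsto : Tendsto (fun m : ℕ => (m:ℝ) + 1) atTop atTop :=
  tendsto_atTop_add_const_right _ _ tendsto_natCast_atTop_atTop

/-- a function continuous on `(0,∞)` with limits at both ends is bounded -/
lemma aux_bdd {h : ℝ → ℝ} (hc : ContinuousOn h (Ioi 0)) {l l' : ℝ}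
    (h0 : Tendsto h (𝓝[>] 0) (𝓝 l)) (h1 : Tendsto h atTop (𝓝 l')) :
    ∃ N : ℕ, ∀ y, 0 < y → |h y| ≤ N := by
  have e0 : ∀ᶠ y in 𝓝[>] (0:ℝ), |h y| < |l| + 1 :=
    h0.abs.eventually (gt_mem_nhds (by linarith))
  have e1 : ∀ᶠ y in atTop, |h y| < |l'| + 1 :=
    h1.abs.eventually (gt_mem_nhds (by linarith))
  obtain ⟨ε, hε, he0⟩ := (mem_nhdsGT_iff_exists_Ioo_subset).1 e0
  obtain ⟨R, he1⟩ := eventually_atTop.1 e1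
  have hε' : (0:ℝ) < ε := hε
  obtain ⟨C, hC⟩ := (isCompact_Icc (a := ε) (b := R)).exists_bound_of_continuousOn
    (hc.mono fun y hy => lt_of_lt_of_le hε' hy.1)
  obtain ⟨N, hN⟩ := exists_nat_ge (max C (max (|l| + 1) (|l'| + 1)))
  refine ⟨N, fun y hy => ?_⟩
  have hN1 : C ≤ N := (le_max_left _ _).trans hN
  have hN2 : |l| + 1 ≤ N := ((le_max_left _ _).trans (le_max_right _ _)).trans hN
  have hN3 : |l'| + 1 ≤ N := ((le_max_right _ _).trans (le_max_right _ _)).trans hN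
  rcases lt_or_ge y ε with hlt | hge
  · have : |h y| < |l| + 1 := he0 ⟨hy, hlt⟩
    linarith
  · rcases le_or_gt y R with h' | h'
    · have := hC y ⟨hge, h'⟩
      rw [Real.norm_eq_abs] at this
      linarith
    · have := he1 y h'.le
      linarith

/-- abstract core of the argument -/
lemma aux_core (g h k : ℝ → ℝ → ℝ) (h0 Ψ ψ : ℝ → ℝ) (c : ℝ) (hc : 0 < c)
    (hg : ContinuousOn (fun p : ℝ × ℝ => g p.1 p.2) {p : ℝ × ℝ | 0 < p.1 ∧ 0 < p.2})
    (hh : ContinuousOn (fun p : ℝ × ℝ => h p.1 p.2) {p : ℝ × ℝ | 0 < p.1 ∧ 0 < p.2})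
    (hk : ∀ r y : ℝ, 0 < r → 0 < y → HasDerivAt (fun s => k s y) (2 * g r y) r)
    (hT : ∀ r ε R : ℝ, 0 < r → 0 < ε → ε ≤ R → ∫ y in ε..R, g r y ≤ h r ε - h r R)
    (hh0 : ∀ r, 0 < r → Tendsto (h r) (𝓝[>] 0) (𝓝 (h0 r)))
    (hh1 : ∀ r, 0 < r → Tendsto (h r) atTop (𝓝 0))
    (hki : ∀ r, 0 < r → IntegrableOn (k r) (Ioi 0))
    (hJ : ∀ r, 0 < r → HasDerivAt (fun s => ∫ y in Ioi (0:ℝ), k s y)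
      (2 * ∫ y in Ioi (0:ℝ), g r y) r)
    (hΨ : ∀ r, 0 < r → HasDerivAt Ψ (ψ r) r)
    (hψ : ContinuousOn ψ (Ioi 0))
    (hψh : ∀ r, 0 < r → ψ r + 2 * c * h0 r ≤ 0) :
    AntitoneOn (fun r => Ψ r + c * ∫ y in Ioi (0:ℝ), k r y) (Ioi 0) := by
  -- slices
  have hgy : ∀ r, 0 < r → ContinuousOn (g r) (Ioi 0) := fun r hr =>
    hg.comp (f := fun y : ℝ => (r, y)) (by fun_prop) fun y hy => ⟨hr, hy⟩
  have hgr : ∀ y, 0 < y → ContinuousOn (fun r => g r y) (Ioi 0) := fun y hy =>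
    hg.comp (f := fun r : ℝ => (r, y)) (by fun_prop) fun r hr => ⟨hr, hy⟩
  have hhy : ∀ r, 0 < r → ContinuousOn (h r) (Ioi 0) := fun r hr =>
    hh.comp (f := fun y : ℝ => (r, y)) (by fun_prop) fun y hy => ⟨hr, hy⟩
  have hhr : ∀ y, 0 < y → ContinuousOn (fun r => h r y) (Ioi 0) := fun y hy =>
    hh.comp (f := fun r : ℝ => (r, y)) (by fun_prop) fun r hr => ⟨hr, hy⟩
  have hI : ∀ r, 0 < r → HasDerivAt (fun r => Ψ r + c * ∫ y in Ioi (0:ℝ), k r y)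
      (ψ r + c * (2 * ∫ y in Ioi (0:ℝ), g r y)) r := fun r hr =>
    (hΨ r hr).add ((hJ r hr).const_mul c)
  -- the integrable case
  have hgood : ∀ r, 0 < r → IntegrableOn (g r) (Ioi 0) →
      ψ r + c * (2 * ∫ y in Ioi (0:ℝ), g r y) ≤ 0 := by
    intro r hr hi
    have : ∫ y in Ioi (0:ℝ), g r y ≤ h0 r - 0 :=
      le_of_tendsto_of_tendsto' (aux_tendsto_trunc hi)
        (((hh0 r hr).comp aux_eps_tendsto).sub ((hh1 r hr).comp aux_R_tendsto))
        fun m => hT r _ _ hr (aux_eps m).1 (aux_eps m).2.2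
    nlinarith [hψh r hr, mul_le_mul_of_nonneg_left this hc.le]
  have hbad : ∀ r, 0 < r → 0 < ψ r + c * (2 * ∫ y in Ioi (0:ℝ), g r y) →
      ∫ y in Ioi (0:ℝ), g r y = 0 := by
    intro r hr hpos
    apply integral_undef
    intro hi
    exact absurd (hgood r hr hi) (not_le.2 hpos)
  have key : ∀ r, 0 < r → ψ r + c * (2 * ∫ y in Ioi (0:ℝ), g r y) ≤ 0 := by
    intro r₀ hr₀
    by_contra hcon
    push Not at hcon
    have hψ0 : 0 < ψ r₀ := by
      have := hbad r₀ hr₀ hcon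
      rw [this] at hcon; simpa using hcon
    have hev : ∀ᶠ r in 𝓝 r₀, ψ r₀ / 2 < ψ r ∧ 0 < r := by
      refine ((hψ.continuousAt (Ioi_mem_nhds hr₀)).eventually (lt_mem_nhds (by linarith))).and
        (Ioi_mem_nhds hr₀)
    obtain ⟨δ, hδ, hball⟩ := Metric.eventually_nhds_iff_ball.1 hev
    have hsub : ∀ r ∈ Ioo (r₀ - δ) (r₀ + δ), ψ r₀ / 2 < ψ r ∧ 0 < r := by
      intro r hr
      apply hball
      rwa [Real.ball_eq_Ioo]
    -- Darboux
    have hr₀mem : r₀ ∈ Ioo (r₀ - δ) (r₀ + δ) := ⟨by linarith, by linarith⟩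
    have hdar := hasDerivWithinAt_forall_lt_or_forall_gt_of_forall_ne
      (convex_Ioo (r₀ - δ) (r₀ + δ))
      (fun r hr => (hI r (hsub r hr).2).hasDerivWithinAt) (m := ψ r₀ / 2) (by
        intro r hr heq
        have h1 := hbad r (hsub r hr).2 (by rw [heq]; linarith)
        rw [h1] at heq
        have := (hsub r hr).1
        simp at heq
        linarith)
    have hposall : ∀ r ∈ Ioo (r₀ - δ) (r₀ + δ), ∫ y in Ioi (0:ℝ), g r y = 0 := by
      rcases hdar with hlt | hgt
      · have := hlt r₀ hr₀mem
        rw [hbad r₀ hr₀ hcon] at this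
        simp at this
        linarith
      · intro r hr
        refine hbad r (hsub r hr).2 (lt_trans ?_ (hgt r hr))
        linarith
    -- Baire
    set p := r₀ - δ / 2 with hp
    set q := r₀ + δ / 2 with hq
    have hpq : p < q := by rw [hp, hq]; linarith
    have hcl : ∀ r : ℝ, max p (min r q) ∈ Icc p q := fun r =>
      ⟨le_max_left _ _, max_le hpq.le (min_le_right _ _)⟩
    have hpos' : ∀ r ∈ Icc p q, r ∈ Ioo (r₀ - δ) (r₀ + δ) := fun r hr =>
      ⟨by have := hr.1; rw [hp] at this; linarith, by have := hr.2; rw [hq] at this; linarith⟩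
    have hpos2 : ∀ r ∈ Icc p q, 0 < r := fun r hr => (hsub r (hpos' r hr)).2
    let C : ℕ → Set ℝ := fun N => ⋂ y ∈ Ioi (0:ℝ), {r : ℝ | |h (max p (min r q)) y| ≤ N}
    have hCc : ∀ N, IsClosed (C N) := by
      intro N
      refine isClosed_biInter fun y hy => ?_
      have hcont : Continuous fun r : ℝ => h (max p (min r q)) y :=
        (hhr y hy).comp_continuous (by fun_prop) fun r => hpos2 _ (hcl r)
      exact isClosed_le hcont.abs continuous_const
    have hCu : ⋃ N, C N = univ := by
      refine eq_univ_of_forall fun r => ?_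
      have hr := hpos2 _ (hcl r)
      obtain ⟨N, hN⟩ := aux_bdd (hhy _ hr) (hh0 _ hr) (hh1 _ hr)
      exact mem_iUnion.2 ⟨N, mem_iInter₂.2 fun y hy => hN y hy⟩
    have hdense := dense_iUnion_interior_of_closed hCc hCu
    obtain ⟨s, hs, hsU⟩ := hdense.exists_mem_open isOpen_Ioo (nonempty_Ioo.2 hpq)
    obtain ⟨N, hN⟩ := mem_iUnion.1 hs
    have hnh : Ioo p q ∩ interior (C N) ∈ 𝓝 s :=
      inter_mem (isOpen_Ioo.mem_nhds hsU) (isOpen_interior.mem_nhds hN)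
    obtain ⟨η, hη, hball2⟩ := Metric.nhds_basis_closedBall.mem_iff.1 hnh
    rw [Real.closedBall_eq_Icc] at hball2
    set p' := s - η
    set q' := s + η
    have hpq' : p' < q' := by simp only [p', q']; linarith
    have hin : ∀ r ∈ Icc p' q', r ∈ Icc p q := fun r hr => Ioo_subset_Icc_self (hball2 hr).1
    have hpos3 : ∀ r ∈ Icc p' q', 0 < r := fun r hr => hpos2 r (hin r hr)
    have hbound : ∀ r ∈ Icc p' q', ∀ y, 0 < y → |h r y| ≤ N := by
      intro r hr y hy
      have h1 := interior_subset (hball2 hr).2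
      have h2 : |h (max p (min r q)) y| ≤ N := (mem_iInter₂.1 h1) y hy
      have hr' := hin r hr
      rwa [min_eq_left hr'.2, max_eq_right hr'.1] at h2
    -- J is constant
    have hJc : ∫ y in Ioi (0:ℝ), k q' y = ∫ y in Ioi (0:ℝ), k p' y := by
      have := (convex_Icc p' q').is_const_of_fderivWithin_eq_zero (𝕜 := ℝ)
        (f := fun s => ∫ y in Ioi (0:ℝ), k s y)
        (fun r hr => (hJ r (hpos3 r hr)).differentiableAt.differentiableWithinAt)
        (fun r hr => by
          have hd := hJ r (hpos3 r hr)
          rw [hposall r (hpos' r (hin r hr)), mul_zero] at hd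
          have := hd.hasFDerivAt.hasFDerivWithinAt (s := Icc p' q')
          rw [this.fderivWithin (uniqueDiffOn_Icc hpq' r hr)]
          ext; simp)
        (right_mem_Icc.2 hpq'.le) (left_mem_Icc.2 hpq'.le)
      exact this
    have hup : uIcc p' q' = Icc p' q' := uIcc_of_le hpq'.le
    have htr : ∀ ε R : ℝ, 0 < ε → ε ≤ R →
        (∫ y in ε..R, k q' y) - (∫ y in ε..R, k p' y)
          ≤ ∫ r in p'..q', 2 * (h r ε - h r R) := by
      intro ε R hε hεR
      have huy : uIcc ε R = Icc ε R := uIcc_of_le hεR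
      have hypos : ∀ y ∈ Icc ε R, 0 < y := fun y hy => lt_of_lt_of_le hε hy.1
      have hrect : ContinuousOn (fun p : ℝ × ℝ => 2 * g p.1 p.2) (Icc p' q' ×ˢ Icc ε R) :=
        (hg.mono fun z hz => ⟨hpos3 _ hz.1, hypos _ hz.2⟩).const_smul (2:ℝ)
      have hsw : IntegrableOn (Function.uncurry fun r y => 2 * g r y)
          (uIoc p' q' ×ˢ uIoc ε R) (volume.prod volume) := by
        have : IntegrableOn (fun p : ℝ × ℝ => 2 * g p.1 p.2) (Icc p' q' ×ˢ Icc ε R) volume :=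
          hrect.integrableOn_compact (isCompact_Icc.prod isCompact_Icc)
        refine IntegrableOn.mono_set this (prod_mono ?_ ?_)
        · rw [← hup]; exact uIoc_subset_uIcc
        · rw [← huy]; exact uIoc_subset_uIcc
      have hswap : ∫ r in p'..q', ∫ y in ε..R, 2 * g r y = ∫ y in ε..R, ∫ r in p'..q', 2 * g r y := by
        apply MeasureTheory.intervalIntegral_intervalIntegral_swap
        exact hsw
      have hkI : ∀ r, 0 < r → IntervalIntegrable (k r) volume ε R := fun r hr =>
        (intervalIntegrable_iff_integrableOn_Ioc_of_le hεR).2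
          ((hki r hr).mono_set fun y hy => lt_trans hε hy.1)
      have hFTC : ∀ y ∈ uIcc ε R, k q' y - k p' y = ∫ r in p'..q', 2 * g r y := by
        intro y hy
        rw [huy] at hy
        refine (intervalIntegral.integral_eq_sub_of_hasDerivAt (f := fun s => k s y) ?_ ?_).symm
        · intro r hr
          rw [hup] at hr
          exact hk r y (hpos3 r hr) (hypos y hy)
        · apply ContinuousOn.intervalIntegrable
          rw [hup]
          exact ((hgr y (hypos y hy)).mono hpos3).const_smul (2:ℝ)
      rw [← intervalIntegral.integral_sub (hkI _ (hpos3 _ (right_mem_Icc.2 hpq'.le)))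
        (hkI _ (hpos3 _ (left_mem_Icc.2 hpq'.le))), intervalIntegral.integral_congr hFTC, ← hswap]
      refine intervalIntegral.integral_mono_on hpq'.le ?_ ?_ ?_
      · rw [intervalIntegrable_iff]
        unfold IntegrableOn at hsw
        rw [← Measure.prod_restrict] at hsw
        refine hsw.integral_prod_left.congr (Eventually.of_forall fun r => ?_)
        simp only [Function.uncurry_apply_pair]
        rw [intervalIntegral.integral_of_le hεR, uIoc_of_le hεR]
      · apply ContinuousOn.intervalIntegrable
        rw [hup]
        exact (((hhr ε hε).mono hpos3).sub
          ((hhr R (hε.trans_le hεR)).mono hpos3)).const_smul (2:ℝ)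
      · intro r hr
        rw [intervalIntegral.integral_const_mul]
        have := hT r ε R (hpos3 r hr) hε hεR
        linarith
    -- limit
    have hlim : Tendsto (fun m : ℕ => ∫ r in p'..q', 2 * (h r (1 / ((m:ℝ) + 1)) - h r ((m:ℝ) + 1)))
        atTop (𝓝 (∫ r in p'..q', 2 * (h0 r - 0))) := by
      refine intervalIntegral.tendsto_integral_filter_of_dominated_convergence
        (fun _ => 4 * (N:ℝ)) ?_ ?_ ?_ ?_
      · refine Eventually.of_forall fun m => ?_
        refine ContinuousOn.aestronglyMeasurable ?_ measurableSet_uIoc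
        have : ContinuousOn (fun r => 2 * (h r (1 / ((m:ℝ) + 1)) - h r ((m:ℝ) + 1))) (Icc p' q') :=
          (((hhr _ (aux_eps m).1).mono hpos3).sub
            ((hhr _ (aux_eps m).2.1).mono hpos3)).const_smul (2:ℝ)
        exact this.mono (hup ▸ uIoc_subset_uIcc)
      · refine Eventually.of_forall fun m => Eventually.of_forall fun r hr => ?_
        have hr' : r ∈ Icc p' q' := hup ▸ uIoc_subset_uIcc hr
        have h1 := abs_le.1 (hbound r hr' _ (aux_eps m).1)
        have h2 := abs_le.1 (hbound r hr' _ (aux_eps m).2.1)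
        rw [Real.norm_eq_abs, abs_le]
        constructor <;> linarith [h1.1, h1.2, h2.1, h2.2]
      · exact intervalIntegrable_const
      · refine Eventually.of_forall fun r hr => ?_
        have hr' : r ∈ Icc p' q' := hup ▸ uIoc_subset_uIcc hr
        have hr0 := hpos3 r hr'
        exact (((hh0 r hr0).comp aux_eps_tendsto).sub
          ((hh1 r hr0).comp aux_R_tendsto)).const_mul 2
    have hq0 := hpos3 _ (right_mem_Icc.2 hpq'.le)
    have hp0 := hpos3 _ (left_mem_Icc.2 hpq'.le)
    have hfin := le_of_tendsto_of_tendsto'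
      ((aux_tendsto_trunc (hki _ hq0)).sub (aux_tendsto_trunc (hki _ hp0))) hlim
      (fun m => htr _ _ (aux_eps m).1 (aux_eps m).2.2)
    rw [hJc, sub_self] at hfin
    have hneg : ∫ r in p'..q', 2 * (h0 r - 0) ≤ ∫ r in p'..q', (-(ψ r₀ / (2 * c))) := by
      by_cases hii : IntervalIntegrable (fun r => 2 * (h0 r - 0)) volume p' q'
      · refine intervalIntegral.integral_mono_on hpq'.le hii intervalIntegrable_const ?_
        intro r hr
        have h1 := hψh r (hpos3 r hr)
        have h2 := (hsub r (hpos' r (hin r hr))).1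
        rw [le_neg, div_le_iff₀ (by positivity)]
        nlinarith
      · exfalso
        apply hii
        rw [intervalIntegrable_iff]
        have hmeas : AEStronglyMeasurable (fun r => 2 * (h0 r - 0)) (volume.restrict (uIoc p' q')) := by
          refine aestronglyMeasurable_of_tendsto_ae atTop
            (f := fun (m : ℕ) r => 2 * (h r (1 / ((m:ℝ) + 1)) - h r ((m:ℝ) + 1))) ?_ ?_
          · intro m
            refine ContinuousOn.aestronglyMeasurable ?_ measurableSet_uIoc
            have : ContinuousOn (fun r => 2 * (h r (1 / ((m:ℝ) + 1)) - h r ((m:ℝ) + 1)))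
                (Icc p' q') :=
              (((hhr _ (aux_eps m).1).mono hpos3).sub
                ((hhr _ (aux_eps m).2.1).mono hpos3)).const_smul (2:ℝ)
            exact this.mono (hup ▸ uIoc_subset_uIcc)
          · refine (ae_restrict_iff' measurableSet_uIoc).2 (Eventually.of_forall fun r hr => ?_)
            have hr' : r ∈ Icc p' q' := hup ▸ uIoc_subset_uIcc hr
            have hr0 := hpos3 r hr'
            exact (((hh0 r hr0).comp aux_eps_tendsto).sub
              ((hh1 r hr0).comp aux_R_tendsto)).const_mul 2
        have hconst : IntegrableOn (fun _ : ℝ => 2 * (N:ℝ)) (uIoc p' q') :=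
          intervalIntegrable_iff.1 intervalIntegrable_const
        refine Integrable.mono' hconst hmeas ?_
        refine (ae_restrict_iff' measurableSet_uIoc).2 (Eventually.of_forall fun r hr => ?_)
        have hr' : r ∈ Icc p' q' := hup ▸ uIoc_subset_uIcc hr
        have hb : |h0 r| ≤ N := by
          refine le_of_tendsto (hh0 r (hpos3 r hr')).abs ?_
          filter_upwards [self_mem_nhdsWithin] with y hy
          exact hbound r hr' y hy
        rw [Real.norm_eq_abs, sub_zero, abs_mul, abs_two]
        linarith
    rw [intervalIntegral.integral_const, smul_eq_mul] at hneg
    have : 0 < (q' - p') * (ψ r₀ / (2 * c)) := mul_pos (by linarith) (by positivity)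
    linarith
  refine antitoneOn_of_deriv_nonpos (convex_Ioi 0)
    (fun r hr => (hI r hr).continuousAt.continuousWithinAt) ?_ ?_
  · intro r hr
    rw [interior_Ioi] at hr
    exact (hI r hr).differentiableAt.differentiableWithinAt
  · intro r hr
    rw [interior_Ioi] at hr
    rw [(hI r hr).deriv]
    exact key r hr

lemma aux_isOpen_Q : IsOpen {p : ℝ × ℝ | 0 < p.1 ∧ 0 < p.2} :=
  (isOpen_lt continuous_const continuous_fst).inter (isOpen_lt continuous_const continuous_snd)

lemma aux_fX {W : ℝ → ℝ → ℝ} {r y : ℝ}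
    (h : DifferentiableAt ℝ (fun p : ℝ × ℝ => W p.1 p.2) (r, y)) :
    HasDerivAt (fun s => W s y) (fderiv ℝ (fun p : ℝ × ℝ => W p.1 p.2) (r, y) (1, 0)) r := by
  have hl : HasDerivAt (fun s : ℝ => (s, y)) ((1:ℝ), (0:ℝ)) r :=
    (hasDerivAt_id r).prodMk (hasDerivAt_const r y)
  exact h.hasFDerivAt.comp_hasDerivAt (f := fun s : ℝ => (s, y)) r hl

lemma aux_fY {W : ℝ → ℝ → ℝ} {r y : ℝ}
    (h : DifferentiableAt ℝ (fun p : ℝ × ℝ => W p.1 p.2) (r, y)) :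
    HasDerivAt (fun t => W r t) (fderiv ℝ (fun p : ℝ × ℝ => W p.1 p.2) (r, y) (0, 1)) y := by
  have hl : HasDerivAt (fun t : ℝ => (r, t)) ((0:ℝ), (1:ℝ)) y :=
    (hasDerivAt_const y r).prodMk (hasDerivAt_id y)
  exact h.hasFDerivAt.comp_hasDerivAt (f := fun t : ℝ => (r, t)) y hl

/-- smoothness on the open quadrant -/
def SmQ (W : ℝ → ℝ → ℝ) : Prop :=
  ContDiffOn ℝ (⊤ : ℕ∞) (fun p : ℝ × ℝ => W p.1 p.2) {p : ℝ × ℝ | 0 < p.1 ∧ 0 < p.2}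

lemma SmQ.contDiffAt {W : ℝ → ℝ → ℝ} (h : SmQ W) {r y : ℝ} (hr : 0 < r) (hy : 0 < y) :
    ContDiffAt ℝ (⊤ : ℕ∞) (fun p : ℝ × ℝ => W p.1 p.2) (r, y) :=
  ContDiffOn.contDiffAt h (aux_isOpen_Q.mem_nhds ⟨hr, hy⟩)

lemma SmQ.diff {W : ℝ → ℝ → ℝ} (h : SmQ W) {r y : ℝ} (hr : 0 < r) (hy : 0 < y) :
    DifferentiableAt ℝ (fun p : ℝ × ℝ => W p.1 p.2) (r, y) :=
  (h.contDiffAt hr hy).differentiableAt (by simp)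

lemma SmQ.hX {W : ℝ → ℝ → ℝ} (h : SmQ W) {r y : ℝ} (hr : 0 < r) (hy : 0 < y) :
    HasDerivAt (fun s => W s y) (dX W r y) r :=
  (aux_fX (h.diff hr hy)).differentiableAt.hasDerivAt

lemma SmQ.hY {W : ℝ → ℝ → ℝ} (h : SmQ W) {r y : ℝ} (hr : 0 < r) (hy : 0 < y) :
    HasDerivAt (fun t => W r t) (dY W r y) y :=
  (aux_fY (h.diff hr hy)).differentiableAt.hasDerivAt

lemma SmQ.smX {W : ℝ → ℝ → ℝ} (h : SmQ W) : SmQ (dX W) := by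
  have h1 := ContDiffOn.fderiv_of_isOpen (m := ((⊤ : ℕ∞) : WithTop ℕ∞)) h aux_isOpen_Q (by simp)
  have h2 := h1.clm_apply (contDiffOn_const (c := ((1:ℝ), (0:ℝ))))
  refine h2.congr ?_
  rintro ⟨r, y⟩ ⟨hr, hy⟩
  exact (aux_fX (h.diff hr hy)).deriv

lemma SmQ.smY {W : ℝ → ℝ → ℝ} (h : SmQ W) : SmQ (dY W) := by
  have h1 := ContDiffOn.fderiv_of_isOpen (m := ((⊤ : ℕ∞) : WithTop ℕ∞)) h aux_isOpen_Q (by simp)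
  have h2 := h1.clm_apply (contDiffOn_const (c := ((0:ℝ), (1:ℝ))))
  refine h2.congr ?_
  rintro ⟨r, y⟩ ⟨hr, hy⟩
  exact (aux_fY (h.diff hr hy)).deriv

lemma SmQ.symm {W : ℝ → ℝ → ℝ} (h : SmQ W) {r y : ℝ} (hr : 0 < r) (hy : 0 < y) :
    dY (dX W) r y = dX (dY W) r y := by
  have hsy := (h.contDiffAt hr hy).isSymmSndFDerivAt (by
    rw [minSmoothness_of_isRCLikeNormedField]; exact WithTop.coe_le_coe.2 (le_top : (2:ℕ∞) ≤ ⊤))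
  have h1 := ContDiffOn.fderiv_of_isOpen (m := ((⊤ : ℕ∞) : WithTop ℕ∞)) h aux_isOpen_Q (by simp)
  have hd : DifferentiableAt ℝ (fderiv ℝ (fun p : ℝ × ℝ => W p.1 p.2)) (r, y) :=
    (h1.contDiffAt (aux_isOpen_Q.mem_nhds ⟨hr, hy⟩)).differentiableAt (by simp)
  have eX : (fun p : ℝ × ℝ => dX W p.1 p.2) =ᶠ[𝓝 (r, y)]
      fun p => fderiv ℝ (fun p : ℝ × ℝ => W p.1 p.2) p (1, 0) := by
    filter_upwards [aux_isOpen_Q.mem_nhds (show (r, y) ∈ {p : ℝ × ℝ | 0 < p.1 ∧ 0 < p.2} from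
      ⟨hr, hy⟩)] with p hp
    exact (aux_fX (h.diff hp.1 hp.2)).deriv
  have eY : (fun p : ℝ × ℝ => dY W p.1 p.2) =ᶠ[𝓝 (r, y)]
      fun p => fderiv ℝ (fun p : ℝ × ℝ => W p.1 p.2) p (0, 1) := by
    filter_upwards [aux_isOpen_Q.mem_nhds (show (r, y) ∈ {p : ℝ × ℝ | 0 < p.1 ∧ 0 < p.2} from
      ⟨hr, hy⟩)] with p hp
    exact (aux_fY (h.diff hp.1 hp.2)).deriv
  have a1 : dY (dX W) r y = _ := (aux_fY (h.smX.diff hr hy)).deriv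
  have a2 : dX (dY W) r y = _ := (aux_fX (h.smY.diff hr hy)).deriv
  rw [a1, a2, eX.fderiv_eq, eY.fderiv_eq]
  rw [(hd.hasFDerivAt.clm_apply (hasFDerivAt_const ((1:ℝ), (0:ℝ)) (r, y))).fderiv,
    (hd.hasFDerivAt.clm_apply (hasFDerivAt_const ((0:ℝ), (1:ℝ)) (r, y))).fderiv]
  simpa using hsy (0, 1) (1, 0)

/-- continuity of `∂ₓ v` up to the boundary -/
lemma aux_dX_tendsto {v : ℝ → ℝ → ℝ}
    (hsm : ContDiffOn ℝ (⊤ : ℕ∞) (fun p : ℝ × ℝ => v p.1 p.2) {p : ℝ × ℝ | 0 < p.1 ∧ 0 ≤ p.2})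
    {r : ℝ} (hr : 0 < r) : Tendsto (fun y => dX v r y) (𝓝[>] 0) (𝓝 (dX v r 0)) := by
  set S := {p : ℝ × ℝ | 0 < p.1 ∧ 0 ≤ p.2} with hS
  have hconv : Convex ℝ S := by
    have : S = Ioi (0:ℝ) ×ˢ Ici (0:ℝ) := rfl
    rw [this]
    exact (convex_Ioi 0).prod (convex_Ici 0)
  have hU : UniqueDiffOn ℝ S := by
    have : S = Ioi (0:ℝ) ×ˢ Ici (0:ℝ) := rfl
    rw [this]
    exact (uniqueDiffOn_Ioi 0).prod (uniqueDiffOn_Ici 0)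
  have hc := hsm.continuousOn_fderivWithin hU (by simp)
  have heq : ∀ y, 0 ≤ y → dX v r y = fderivWithin ℝ (fun p : ℝ × ℝ => v p.1 p.2) S (r, y) (1, 0) := by
    intro y hy
    have hd := ((hsm.differentiableOn (by simp)) (r, y) ⟨hr, hy⟩).hasFDerivWithinAt
    have hl : HasDerivWithinAt (fun s : ℝ => (s, y)) ((1:ℝ), (0:ℝ)) (Ioi 0) r :=
      ((hasDerivAt_id r).prodMk (hasDerivAt_const r y)).hasDerivWithinAt
    have := hd.comp_hasDerivWithinAt (f := fun s : ℝ => (s, y)) r hl (fun s hs => ⟨hs, hy⟩)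
    exact (this.hasDerivAt (Ioi_mem_nhds hr)).deriv
  have hcont : ContinuousWithinAt (fun y => dX v r y) (Ici 0) 0 := by
    have h1 : ContinuousOn (fun y : ℝ => fderivWithin ℝ (fun p : ℝ × ℝ => v p.1 p.2) S (r, y)
        ((1:ℝ), (0:ℝ))) (Ici 0) :=
      (hc.comp (f := fun y : ℝ => (r, y)) (by fun_prop) (fun y hy => ⟨hr, hy⟩)).clm_apply
        continuousOn_const
    exact (h1.congr fun y hy => heq y hy) 0 self_mem_Ici
  exact hcont.mono_left (nhdsWithin_mono _ Ioi_subset_Ici_self)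

/-- monotonicity formula for radial extension solutions. -/
theorem stmt_8 (n : ℕ) (hn : 1 ≤ n)
    (α a c dα : ℝ) (hα : 0 < α) (hα2 : α < 2) (ha : a = 1 - α)
    (hc : 0 < c) (hd : 0 < dα)
    (f F : ℝ → ℝ) (hf : ContDiff ℝ 1 f) (hF : ContDiff ℝ 1 F)
    (hF' : ∀ t, deriv F t = - f t)
    (v : ℝ → ℝ → ℝ)
    (hbd : ∃ M, ∀ r y : ℝ, 0 < r → 0 ≤ y → |v r y| ≤ M)
    (hsm : ContDiffOn ℝ (⊤ : ℕ∞) (fun p : ℝ × ℝ => v p.1 p.2) {p : ℝ × ℝ | 0 < p.1 ∧ 0 ≤ p.2})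
    -- the radial extension equation ∂ᵣᵣv + ((n-1)/r)∂ᵣv + ∂_yy v + (a/y)∂_y v = 0:
    (hext : ∀ r y : ℝ, 0 < r → 0 < y →
      dXX v r y + ((n:ℝ) - 1) / r * dX v r y
        + deriv (fun t => dY v r t) y + a / y * dY v r y = 0)
    -- the boundary condition
    -- -lim_{y→0⁺} yᵃ∂_yv = (dα/c)(∂ᵣᵣv(r,0) + ((n-1)/r)∂ᵣv(r,0) + f(v(r,0))):
    (hbc : ∀ r : ℝ, 0 < r → Tendsto (fun y => y ^ a * dY v r y) (𝓝[>] (0:ℝ))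
      (𝓝 (-(dα / c) * (iteratedDeriv 2 (fun s => v s 0) r
        + ((n:ℝ) - 1) / r * dX v r 0 + f (v r 0)))))
    -- integrability and vanishing at infinity:
    (hint : ∀ r : ℝ, 0 < r →
      IntegrableOn (fun y => y ^ a * ((dX v r y) ^ 2 + (dY v r y) ^ 2)) (Ioi 0))
    (hylim : ∀ r : ℝ, 0 < r →
      Tendsto (fun y => y ^ a * (dX v r y * dY v r y)) atTop (𝓝 0))
    -- differentiation under the integral sign:
    (hD : ∀ r : ℝ, 0 < r →
      HasDerivAt (fun s => ∫ y in Ioi (0:ℝ), y ^ a * ((dX v s y) ^ 2 - (dY v s y) ^ 2))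
        (2 * ∫ y in Ioi (0:ℝ), y ^ a * (dX v r y * dXX v r y - dY v r y * dXY v r y)) r) :
    AntitoneOn (fun r =>
      dα * (dX v r 0) ^ 2
        + c * (∫ y in Ioi (0:ℝ), y ^ a * ((dX v r y) ^ 2 - (dY v r y) ^ 2))
        - 2 * dα * F (v r 0)) (Ioi 0) := by
  have hv : SmQ v := hsm.mono fun p hp => ⟨hp.1, hp.2.le⟩
  -- the trace
  have hu : ContDiffOn ℝ (⊤ : ℕ∞) (fun s => v s 0) (Ioi 0) :=
    hsm.comp (f := fun s : ℝ => (s, (0:ℝ))) (by fun_prop) fun s hs => ⟨hs, le_refl _⟩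
  have hu1 : ContDiffOn ℝ (⊤ : ℕ∞) (fun s => dX v s 0) (Ioi 0) :=
    hu.deriv_of_isOpen isOpen_Ioi (by simp)
  have hu2 : ContDiffOn ℝ (⊤ : ℕ∞) (deriv (fun s => dX v s 0)) (Ioi 0) :=
    hu1.deriv_of_isOpen isOpen_Ioi (by simp)
  have hud : ∀ r, 0 < r → HasDerivAt (fun s => v s 0) (dX v r 0) r := fun r hr =>
    ((hu.contDiffAt (Ioi_mem_nhds hr)).differentiableAt (by simp)).hasDerivAt
  have hud1 : ∀ r, 0 < r → HasDerivAt (fun s => dX v s 0) (deriv (fun s => dX v s 0) r) r :=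
    fun r hr => ((hu1.contDiffAt (Ioi_mem_nhds hr)).differentiableAt (by simp)).hasDerivAt
  have hit : ∀ r, iteratedDeriv 2 (fun s => v s 0) r = deriv (fun s => dX v s 0) r := by
    intro r
    rw [iteratedDeriv_succ, iteratedDeriv_one]
    rfl
  have hFd : ∀ t, HasDerivAt F (- f t) t := fun t => by
    have := ((hF.differentiable (by simp)) t).hasDerivAt
    rwa [hF'] at this
  have hn1 : (0:ℝ) ≤ (n:ℝ) - 1 := by
    have : (1:ℝ) ≤ n := by exact_mod_cast hn
    linarith
  have hcQ : ∀ {W : ℝ → ℝ → ℝ}, SmQ W →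
      ContinuousOn (fun p : ℝ × ℝ => W p.1 p.2) {p : ℝ × ℝ | 0 < p.1 ∧ 0 < p.2} :=
    fun hW => ContDiffOn.continuousOn hW
  have hya : ContinuousOn (fun p : ℝ × ℝ => p.2 ^ a) {p : ℝ × ℝ | 0 < p.1 ∧ 0 < p.2} :=
    continuousOn_snd.rpow_const fun p hp => Or.inl hp.2.ne'
  have hgc : ContinuousOn (fun p : ℝ × ℝ => p.2 ^ a * (dX v p.1 p.2 * dXX v p.1 p.2
      - dY v p.1 p.2 * dXY v p.1 p.2)) {p : ℝ × ℝ | 0 < p.1 ∧ 0 < p.2} :=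
    hya.mul (((hcQ hv.smX).mul (hcQ hv.smX.smX)).sub ((hcQ hv.smY).mul (hcQ hv.smY.smX)))
  have hslice : ∀ {W : ℝ → ℝ → ℝ} {r : ℝ}, 0 < r →
      ContinuousOn (fun p : ℝ × ℝ => W p.1 p.2) {p : ℝ × ℝ | 0 < p.1 ∧ 0 < p.2} →
      ContinuousOn (W r) (Ioi 0) := fun {W r} hr hW =>
    hW.comp (f := fun y : ℝ => (r, y)) (by fun_prop) fun y hy => ⟨hr, hy⟩
  have main := aux_core
    (fun r y => y ^ a * (dX v r y * dXX v r y - dY v r y * dXY v r y))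
    (fun r y => y ^ a * (dX v r y * dY v r y))
    (fun r y => y ^ a * ((dX v r y) ^ 2 - (dY v r y) ^ 2))
    (fun r => dX v r 0 * (-(dα / c) * (iteratedDeriv 2 (fun s => v s 0) r
        + ((n:ℝ) - 1) / r * dX v r 0 + f (v r 0))))
    (fun r => dα * (dX v r 0) ^ 2 - 2 * dα * F (v r 0))
    (fun r => 2 * dα * (dX v r 0 * (deriv (fun s => dX v s 0) r + f (v r 0))))
    c hc hgc (hya.mul ((hcQ hv.smX).mul (hcQ hv.smY))) ?_ ?_ ?_ hylim ?_ hD ?_ ?_ ?_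
  · refine main.congr fun r _ => ?_
    simp only
    ring
  · intro r y hr hy
    have h1 := (hv.smX.hX hr hy).pow 2
    have h2 := (hv.smY.hX hr hy).pow 2
    refine ((h1.sub h2).const_mul (y ^ a)).congr_deriv ?_
    simp only [dXX, dXY]
    simp only [dX]
    push_cast
    ring
  · intro r ε R hr hε hεR
    have hpos : ∀ y ∈ Icc ε R, 0 < y := fun y hy => lt_of_lt_of_le hε hy.1
    have huy : uIcc ε R = Icc ε R := uIcc_of_le hεR
    have hder : ∀ y, 0 < y → HasDerivAt (fun y => -(y ^ a * (dX v r y * dY v r y)))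
        (y ^ a * (dX v r y * dXX v r y - dY v r y * dXY v r y)
          + ((n:ℝ) - 1) / r * (y ^ a * dX v r y ^ 2)) y := by
      intro y hy
      have h1 := hv.smX.hY hr hy
      have h2 := hv.smY.hY hr hy
      have h3 := Real.hasDerivAt_rpow_const (p := a) (Or.inl hy.ne')
      refine (h3.mul (h1.mul h2)).neg.congr_deriv ?_
      rw [hv.symm hr hy]
      have hE := hext r y hr hy
      have e1 : dX (dY v) r y = dXY v r y := rfl
      have e2 : deriv (fun t => dY v r t) y = dY (dY v) r y := rfl
      rw [e2] at hE
      rw [e1, Real.rpow_sub_one hy.ne']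
      have hE' : dY (dY v) r y = -(dXX v r y + ((n:ℝ) - 1) / r * dX v r y + a / y * dY v r y) := by
        linarith
      rw [hE']
      simp only [Pi.mul_apply]
      ring
    have hc1 : ContinuousOn (fun y => y ^ a * (dX v r y * dXX v r y - dY v r y * dXY v r y))
        (Icc ε R) :=
      (hslice (W := fun r y => y ^ a * (dX v r y * dXX v r y - dY v r y * dXY v r y)) hr hgc).mono
        hpos
    have hc2 : ContinuousOn (fun y => y ^ a * dX v r y ^ 2) (Icc ε R) :=
      (hslice (W := fun r y => y ^ a * dX v r y ^ 2) hr
        (hya.mul ((hcQ hv.smX).pow 2))).mono hpos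
    have hc3 := hc1.add (hc2.const_smul (((n:ℝ) - 1) / r))
    have hF1 := intervalIntegral.integral_eq_sub_of_hasDerivAt (a := ε) (b := R)
      (fun y hy => hder y (hpos y (huy ▸ hy)))
      (ContinuousOn.intervalIntegrable (by rw [huy]; exact hc3))
    have hle : ∫ y in ε..R, y ^ a * (dX v r y * dXX v r y - dY v r y * dXY v r y) ≤
        ∫ y in ε..R, (y ^ a * (dX v r y * dXX v r y - dY v r y * dXY v r y)
          + ((n:ℝ) - 1) / r * (y ^ a * dX v r y ^ 2)) := by
      refine intervalIntegral.integral_mono_on hεR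
        (ContinuousOn.intervalIntegrable (by rw [huy]; exact hc1))
        (ContinuousOn.intervalIntegrable (by rw [huy]; exact hc3)) fun y hy => ?_
      have h1 : 0 ≤ y ^ a := Real.rpow_nonneg (hpos y hy).le a
      have : 0 ≤ ((n:ℝ) - 1) / r * (y ^ a * dX v r y ^ 2) := by positivity
      linarith
    rw [hF1] at hle
    linarith
  · intro r hr
    refine ((aux_dX_tendsto hsm hr).mul (hbc r hr)).congr fun y => ?_
    ring
  · intro r hr
    have hm : ContinuousOn (fun y => y ^ a * ((dX v r y) ^ 2 - (dY v r y) ^ 2)) (Ioi 0) :=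
      hslice (W := fun r y => y ^ a * ((dX v r y) ^ 2 - (dY v r y) ^ 2)) hr
        (hya.mul (((hcQ hv.smX).pow 2).sub ((hcQ hv.smY).pow 2)))
    refine Integrable.mono' (hint r hr) (hm.aestronglyMeasurable measurableSet_Ioi) ?_
    refine (ae_restrict_iff' measurableSet_Ioi).2 (Eventually.of_forall fun y hy => ?_)
    have h1 : 0 ≤ y ^ a := Real.rpow_nonneg (le_of_lt hy) a
    rw [Real.norm_eq_abs, abs_mul, abs_of_nonneg h1]
    refine mul_le_mul_of_nonneg_left ?_ h1
    rw [abs_le]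
    constructor <;> nlinarith [sq_nonneg (dX v r y), sq_nonneg (dY v r y)]
  · intro r hr
    have h1 := ((hud1 r hr).pow 2).const_mul dα
    have h2 := ((hFd (v r 0)).comp r (hud r hr)).const_mul (2 * dα)
    refine (h1.sub h2).congr_deriv ?_
    push_cast
    ring
  · have hfc : ContinuousOn (fun r => f (v r 0)) (Ioi 0) :=
      hf.continuous.comp_continuousOn hu.continuousOn
    exact (hu1.continuousOn.mul (hu2.continuousOn.add hfc)).const_smul (2 * dα)
  · intro r hr
    rw [hit r]
    have hne := hc.ne'
    have : 0 ≤ 2 * dα * (((n:ℝ) - 1) / r * dX v r 0 ^ 2) := by positivity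
    have e : 2 * dα * (dX v r 0 * (deriv (fun s => dX v s 0) r + f (v r 0)))
        + 2 * c * (dX v r 0 * (-(dα / c) * (deriv (fun s => dX v s 0) r
        + ((n:ℝ) - 1) / r * dX v r 0 + f (v r 0))))
        = -(2 * dα * (((n:ℝ) - 1) / r * dX v r 0 ^ 2)) := by
      have hcc : c * (dα / c) = dα := by field_simp
      linear_combination (-2 * dX v r 0 * (deriv (fun s => dX v s 0) r
        + ((n:ℝ) - 1) / r * dX v r 0 + f (v r 0))) * hcc
    rw [e]
    linarith
end
end
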